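/- arXiv:math/0604224 — 2 statements merged into one kernel-verified Lean document; each statement's English description precedes it below -/
import Mathlib

section
/- Let g ∈ G be a p-regular element with conjugacy class C and centralizer H = C_G(g). Define res_g : R_𝔭(G,C) → R_𝔭(H,1) by (res_g f)(h) = f(gh) if h ∈ H is a p-element and (res_g f)(h) = 0 otherwise, and define ind_g : R_𝔭(H,1) → R_𝔭(G,C) by ind_g f = Ind_H^G(f'), where f'(x) = f(g^{-1}x) for x ∈ H and (Ind_H^G u)(x) = |H|^{-1} · Σ_{y ∈ G with y^{-1}xy ∈ H} u(y^{-1}xy). Then res_g and ind_g are well defined and are mutually inverse isomorphisms of 𝒪_𝔭-algebras between R_𝔭(G,C) and R_𝔭(H,1). -/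
open scoped TensorProduct Classical

/-! Common definitions: the character ring of a finite group, following Bonnafé,
"On the character ring of a finite group". -/

/-- The set of characters of finite-dimensional `K`-linear representations of `G`. -/
def charSet (K G : Type u) [Field K] [Group G] : Set (G → K) :=
  {f | ∃ V : FDRep K G, f = FDRep.character V}

/-- The character ring `R(G)` of virtual characters, i.e. the subring of the `K`-algebra of
functions `G → K` generated by the characters.  Over a splitting field of characteristic zero
this is exactly the set of `ℤ`-linear combinations of irreducible characters. -/
def charRing (K G : Type u) [Field K] [Group G] : Subring (G → K) :=
  Subring.closure (charSet K G)

/-- `g` is `p`-regular if its order is prime to `p`. -/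
def IsPRegular (p : ℕ) {G : Type*} [Monoid G] (g : G) : Prop :=
  Nat.Coprime (orderOf g) p

/-- `g` is a `p`-element if its order is a power of `p`. -/
def IsPElement (p : ℕ) {G : Type*} [Monoid G] (g : G) : Prop :=
  ∃ n : ℕ, orderOf g = p ^ n

/-- The `p'`-part `g_{p'}` of an element `g` of a finite group:  writing `orderOf g = q * m'`
with `q` the `p`-part of the order, this is `g ^ (q * u)` where `u` is the inverse of
`q` modulo `m'`; it is the unique `p`-regular power of `g` such that `g * g_{p'}⁻¹` is a
`p`-element commuting with it. -/
noncomputable def pPrimePart (p : ℕ) {G : Type*} [Group G] (g : G) : G :=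
  g ^ (p ^ (orderOf g).factorization p *
      (((p : ZMod (orderOf g / p ^ (orderOf g).factorization p)) ^
        (orderOf g).factorization p)⁻¹).val)

/-- The `p'`-section `S_{p'}(C)` of the conjugacy class `C` of `g` : the set of all
`x ∈ G` whose `p'`-part lies in the class of `g`. -/
def pSection (p : ℕ) {G : Type*} [Group G] (g : G) : Set G :=
  {x | IsConj g (pPrimePart p x)}

/-- The idempotent class function `e_C` attached to the class `C` of `g`:  the characteristic
function (with values in `K`) of the `p'`-section of `C`. -/
noncomputable def eFun (p : ℕ) (K : Type*) [Field K] {G : Type*} [Group G] (g : G) : G → K :=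
  fun x => if IsConj g (pPrimePart p x) then 1 else 0

/-- The number of conjugacy classes of `G` contained in a subset `S`. -/
noncomputable def numClassesIn {G : Type*} [Group G] (S : Set G) : ℕ :=
  Nat.card {c : ConjClasses G // c.carrier ⊆ S}

/-- The image of the localization `𝒪_𝔭` in the fraction field `K`: fractions `a / b` with
`b ∉ 𝔭`. -/
def locSet (𝒪 K : Type*) [CommRing 𝒪] [Field K] [Algebra 𝒪 K] (𝔭 : Ideal 𝒪) : Set K :=
  {x | ∃ a b : 𝒪, b ∉ 𝔭 ∧ x * algebraMap 𝒪 K b = algebraMap 𝒪 K a}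

/-- `𝒪_𝔭 R(G)`: the `𝒪_𝔭`-span of the character ring inside class functions `G → K`,
realized as the subring generated by `𝒪_𝔭`-constants and characters. -/
def locCharRing (𝒪 : Type*) (K : Type u) [CommRing 𝒪] [Field K] [Algebra 𝒪 K] (𝔭 : Ideal 𝒪)
    (G : Type u) [Group G] : Subring (G → K) :=
  Subring.closure ({f | ∃ x ∈ locSet 𝒪 K 𝔭, f = Function.const G x} ∪ charSet K G)

/-- The ideal `𝔭 · 𝒪_𝔭R(G)` of `𝒪_𝔭R(G)`, generated by the constants from `𝔭`. -/
def pConstIdeal (𝒪 : Type*) (K : Type u) [CommRing 𝒪] [Field K] [Algebra 𝒪 K] (𝔭 : Ideal 𝒪)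
    (G : Type u) [Group G] : Ideal (locCharRing 𝒪 K 𝔭 G) :=
  Ideal.span {f | ∃ a ∈ 𝔭, (f : G → K) = Function.const G (algebraMap 𝒪 K a)}

/-- `kR(G) = k ⊗_ℤ R(G)`, realized through the canonical identification
`k ⊗_ℤ R(G) ≅ 𝒪_𝔭R(G) ⧸ 𝔭·𝒪_𝔭R(G)` (where `k = 𝒪/𝔭`). -/
abbrev kCharRing (𝒪 : Type*) (K : Type u) [CommRing 𝒪] [Field K] [Algebra 𝒪 K] (𝔭 : Ideal 𝒪)
    (G : Type u) [Group G] :=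
  locCharRing 𝒪 K 𝔭 G ⧸ pConstIdeal 𝒪 K 𝔭 G

/-- The ideal of `𝒪_𝔭R(G)` cutting out the block `R_𝔭(G, C)` with identity element the
idempotent `e : 𝒪_𝔭R(G)`, reduced mod `𝔭`:  the block `kR(G)·ē` is canonically the quotient
by `𝔭·𝒪_𝔭R(G) + (1 - e)·𝒪_𝔭R(G)`. -/
def blockIdeal (𝒪 : Type*) (K : Type u) [CommRing 𝒪] [Field K] [Algebra 𝒪 K] (𝔭 : Ideal 𝒪)
    (G : Type u) [Group G] (e : locCharRing 𝒪 K 𝔭 G) : Ideal (locCharRing 𝒪 K 𝔭 G) :=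
  pConstIdeal 𝒪 K 𝔭 G ⊔ Ideal.span {1 - e}

/-- The block `kR_𝔭(G, C) = kR(G)·ē_C` of `kR(G)`, as a (unital) `k`-algebra, realized as the
quotient of `𝒪_𝔭R(G)` by `𝔭·𝒪_𝔭R(G) + (1 - e_C)·𝒪_𝔭R(G)`. -/
abbrev blockAlg (𝒪 : Type*) (K : Type u) [CommRing 𝒪] [Field K] [Algebra 𝒪 K] (𝔭 : Ideal 𝒪)
    (G : Type u) [Group G] (e : locCharRing 𝒪 K 𝔭 G) :=
  locCharRing 𝒪 K 𝔭 G ⧸ blockIdeal 𝒪 K 𝔭 G e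

/-- The constants, as a ring morphism `𝒪 →+* 𝒪_𝔭R(G)`. -/
noncomputable def constRingHom (𝒪 : Type*) (K : Type u) [CommRing 𝒪] [Field K] [Algebra 𝒪 K]
    (𝔭 : Ideal 𝒪) [𝔭.IsMaximal] (G : Type u) [Group G] : 𝒪 →+* locCharRing 𝒪 K 𝔭 G where
  toFun a := ⟨Function.const G (algebraMap 𝒪 K a),
    Subring.subset_closure (Or.inl ⟨algebraMap 𝒪 K a,
      ⟨a, 1, fun h => (Ideal.ne_top_iff_one 𝔭).mp (Ideal.IsMaximal.ne_top ‹_›) h, by simp⟩, rfl⟩)⟩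
  map_one' := Subtype.ext (funext fun g => by simp)
  map_mul' a b := Subtype.ext (funext fun g => by simp)
  map_zero' := Subtype.ext (funext fun g => by simp)
  map_add' a b := Subtype.ext (funext fun g => by simp)

/-- The structural morphism giving quotients of `𝒪_𝔭R(G)` by ideals containing
`𝔭·𝒪_𝔭R(G)` (such as `kR(G)` and its blocks) their `k = 𝒪/𝔭`-algebra structure. -/
noncomputable def kScalars (𝒪 : Type*) (K : Type u) [CommRing 𝒪] [Field K] [Algebra 𝒪 K]
    (𝔭 : Ideal 𝒪) [𝔭.IsMaximal] (G : Type u) [Group G]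
    (I : Ideal (locCharRing 𝒪 K 𝔭 G)) (hI : pConstIdeal 𝒪 K 𝔭 G ≤ I) :
    (𝒪 ⧸ 𝔭) →+* (locCharRing 𝒪 K 𝔭 G ⧸ I) :=
  Ideal.Quotient.lift 𝔭 ((Ideal.Quotient.mk I).comp (constRingHom 𝒪 K 𝔭 G))
    (fun a ha => by
      simp only [RingHom.comp_apply]
      exact Ideal.Quotient.eq_zero_iff_mem.mpr (hI (Ideal.subset_span ⟨a, ha, rfl⟩)))

/-- The `k`-algebra structure morphism of the block `kR_𝔭(G, C)`. -/
noncomputable def blockScalars (𝒪 : Type*) (K : Type u) [CommRing 𝒪] [Field K] [Algebra 𝒪 K]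
    (𝔭 : Ideal 𝒪) [𝔭.IsMaximal] (G : Type u) [Group G] (e : locCharRing 𝒪 K 𝔭 G) :
    (𝒪 ⧸ 𝔭) →+* blockAlg 𝒪 K 𝔭 G e :=
  kScalars 𝒪 K 𝔭 G (blockIdeal 𝒪 K 𝔭 G e) le_sup_left

/-- The Jacobson radical of a ring. -/
noncomputable def jacRad (A : Type*) [CommRing A] : Ideal A := (⊥ : Ideal A).jacobson

/-- The Loewy length of `A`: the least `n` with `(Rad A) ^ n = 0`. -/
noncomputable def loewyLength (A : Type*) [CommRing A] : ℕ :=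
  sInf {n : ℕ | jacRad A ^ n = ⊥}

/-- `Rad A / (Rad A)²`. -/
noncomputable abbrev radQuotient (A : Type*) [CommRing A] :=
  jacRad A ⧸ (Submodule.comap (jacRad A).subtype (jacRad A ^ 2 : Ideal A))

/-- `dim_k Rad(A)/Rad(A)²`, the `k`-vector space structure being induced by a ring morphism
`k →+* A`. -/
noncomputable def extDim (k : Type*) [CommRing k] {A : Type*} [CommRing A] (φ : k →+* A) : ℕ :=
  letI : Module k (radQuotient A) := Module.compHom _ φ
  Module.finrank k (radQuotient A)

/-- `dim_k A`, the `k`-vector space structure being induced by a ring morphism `k →+* A`. -/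
noncomputable def kDim (k : Type*) [CommRing k] {A : Type*} [CommRing A] (φ : k →+* A) : ℕ :=
  letI : Module k A := Module.compHom _ φ
  Module.finrank k A

/-- `dim_k I` for an ideal `I` of `A`, the `k`-vector space structure being induced by a ring
morphism `k →+* A`. -/
noncomputable def idealKDim (k : Type*) [CommRing k] {A : Type*} [CommRing A] (φ : k →+* A)
    (I : Ideal A) : ℕ :=
  letI : Module k I := Module.compHom _ φ
  Module.finrank k I

/-- The map `res_g : R_𝔭(G,C) → R_𝔭(C_G(g),1)`, `(res_g f)(h) = f(gh)` if `h` is a `p`-element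
of `C_G(g)` and `0` otherwise. -/
noncomputable def resFun (p : ℕ) (K : Type u) [Field K] {G : Type u} [Group G] (g : G)
    (f : G → K) : Subgroup.centralizer ({g} : Set G) → K :=
  fun h => if IsPElement p (h : G) then f (g * h) else 0

/-- The map `ind_g : R_𝔭(C_G(g),1) → R_𝔭(G,C)`, `ind_g f = Ind_{C_G(g)}^G f'` where
`f'(x) = f(g⁻¹x)` and `(Ind u)(x) = |C_G(g)|⁻¹ ∑_{y ∈ G, y⁻¹xy ∈ C_G(g)} u(y⁻¹xy)`. -/
noncomputable def indFun (K : Type u) [Field K] {G : Type u} [Group G] [Fintype G] (g : G)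
    (f : Subgroup.centralizer ({g} : Set G) → K) : G → K :=
  fun x => (Nat.card (Subgroup.centralizer ({g} : Set G)) : K)⁻¹ *
    ∑ y : G, if hy : y⁻¹ * x * y ∈ Subgroup.centralizer ({g} : Set G) then
        (if hz : g⁻¹ * (y⁻¹ * x * y) ∈ Subgroup.centralizer ({g} : Set G) then
          f ⟨g⁻¹ * (y⁻¹ * x * y), hz⟩ else 0)
      else 0

section GroupTheory

variable {p : ℕ} {G : Type*} [Group G]

/-- The exponent defining the `p'`-part is `1` modulo the `p'`-part of the order. -/
theorem pPrimePart_exponent_modEq [Fact p.Prime] {n : ℕ} (hn : n ≠ 0) :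
    p ^ n.factorization p *
      (((p : ZMod (n / p ^ n.factorization p)) ^ n.factorization p)⁻¹).val ≡
        1 [MOD n / p ^ n.factorization p] := by
  have hp : p.Prime := Fact.out
  have hc : Nat.Coprime (p ^ n.factorization p) (n / p ^ n.factorization p) :=
    (Nat.coprime_ordCompl hp hn).pow_left _
  have : NeZero (n / p ^ n.factorization p) := ⟨(Nat.ordCompl_pos p hn).ne'⟩
  rw [← ZMod.natCast_eq_natCast_iff]
  push_cast
  rw [ZMod.natCast_zmod_val]
  simpa using ZMod.coe_mul_inv_eq_one _ hc

theorem pPrimePart_mul [Fact p.Prime] {g h : G} (hgh : Commute g h)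
    (hg : IsPRegular p g) (hg₀ : orderOf g ≠ 0) (hh : IsPElement p h) :
    pPrimePart p (g * h) = g := by
  have hp : p.Prime := Fact.out
  obtain ⟨a, ha⟩ := hh
  have hord : orderOf (g * h) = orderOf g * p ^ a := by
    rw [← ha]
    exact hgh.orderOf_mul_eq_mul_orderOf_of_coprime (ha ▸ Nat.Coprime.pow_right a hg)
  have hne : orderOf g * p ^ a ≠ 0 := mul_ne_zero hg₀ (pow_ne_zero _ hp.ne_zero)
  have hf : (orderOf g * p ^ a).factorization p = a := by
    rw [Nat.factorization_mul hg₀ (pow_ne_zero _ hp.ne_zero)]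
    have : ¬ p ∣ orderOf g := (Nat.Prime.coprime_iff_not_dvd hp).1 hg.symm
    simp [Nat.factorization_eq_zero_of_not_dvd this, hp.factorization_self]
  have hk := pPrimePart_exponent_modEq (p := p) hne
  unfold pPrimePart
  rw [hord]
  rw [hf, Nat.mul_div_cancel _ (pow_pos hp.pos a)] at hk ⊢
  rw [hgh.mul_pow, pow_mul h, ← ha, pow_orderOf_eq_one, one_pow, mul_one]
  rw [ha]
  conv_rhs => rw [← pow_one g]
  exact pow_eq_pow_iff_modEq.2 hk

theorem pPrimePart_conj (x y : G) :
    pPrimePart p (y⁻¹ * x * y) = y⁻¹ * pPrimePart p x * y := by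
  have h : orderOf (y⁻¹ * x * y) = orderOf x := by
    simpa using orderOf_injective (MulAut.conj y⁻¹).toMonoidHom (MulAut.conj y⁻¹).injective x
  unfold pPrimePart
  rw [h]
  simpa using (map_pow (MulAut.conj y⁻¹) x _).symm

theorem commute_pPrimePart (x : G) : Commute (pPrimePart p x) x :=
  Commute.pow_self x _

theorem isPElement_inv_pPrimePart_mul [Fact p.Prime] (x : G) (hx : orderOf x ≠ 0) :
    IsPElement p ((pPrimePart p x)⁻¹ * x) := by
  have hk := pPrimePart_exponent_modEq (p := p) hx
  set q := p ^ (orderOf x).factorization p with hq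
  suffices h : ((pPrimePart p x)⁻¹ * x) ^ q = 1 by
    obtain ⟨k, -, hk⟩ := (Nat.dvd_prime_pow Fact.out).1 (orderOf_dvd_of_pow_eq_one h)
    exact ⟨k, hk⟩
  rw [(commute_pPrimePart x).inv_left.mul_pow, inv_pow, inv_mul_eq_one]
  unfold pPrimePart
  rw [← hq, ← pow_mul]
  apply pow_eq_pow_iff_modEq.2
  have := hk.mul_right' q
  rwa [Nat.div_mul_cancel (Nat.ordProj_dvd _ _), one_mul] at this

theorem isPElement_iff_pPrimePart_eq_one [Finite G] [Fact p.Prime] (x : G) :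
    IsPElement p x ↔ pPrimePart p x = 1 := by
  refine ⟨fun h => ?_, fun h => ?_⟩
  · simpa using pPrimePart_mul (Commute.one_left x) (by simp [IsPRegular]) (by simp) h
  · simpa [h] using isPElement_inv_pPrimePart_mul (p := p) x (orderOf_pos x).ne'

theorem isPElement_coe {H : Subgroup G} (h : H) : IsPElement p (h : G) ↔ IsPElement p h := by
  simp [IsPElement]

theorem eFun_one_apply [Finite G] [Fact p.Prime] (K : Type*) [Field K] (x : G) :
    eFun p K (1 : G) x = if IsPElement p x then 1 else 0 := by
  simp only [eFun, isConj_one_right, isPElement_iff_pPrimePart_eq_one]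

/-- Elements with `p'`-part `g` are exactly the products of `g` and a `p`-element of its
centralizer. -/
theorem pPrimePart_eq_iff [Finite G] [Fact p.Prime] {g : G} (hg : IsPRegular p g) (z : G) :
    pPrimePart p z = g ↔
      z ∈ Subgroup.centralizer ({g} : Set G) ∧ IsPElement p (g⁻¹ * z) := by
  refine ⟨?_, fun ⟨hz, h⟩ => ?_⟩
  · rintro rfl
    exact ⟨Subgroup.mem_centralizer_singleton_iff.2 (commute_pPrimePart z).symm,
      isPElement_inv_pPrimePart_mul z (orderOf_pos z).ne'⟩
  · have hc : Commute g z := (Subgroup.mem_centralizer_singleton_iff.1 hz).symm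
    simpa using pPrimePart_mul ((Commute.refl g).inv_right.mul_right hc) hg
      (orderOf_pos g).ne' h

/-- The number of fixed points of a `p`-element on the cosets of a Sylow `p`-subgroup is prime
to `p`. -/
theorem not_dvd_card_fixed_quotient_sylow [Finite G] [Fact p.Prime] (P : Sylow p G) {x : G}
    (hx : IsPElement p x) : ¬ p ∣ Nat.card {y : G ⧸ (P : Subgroup G) // x • y = y} := by
  obtain ⟨a, ha⟩ := hx
  have hP : IsPGroup p (Subgroup.zpowers x) := IsPGroup.of_card (n := a) (by
    rw [Nat.card_zpowers, ha])
  have h := hP.card_modEq_card_fixedPoints (G ⧸ (P : Subgroup G))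
  have he : MulAction.fixedPoints (Subgroup.zpowers x) (G ⧸ (P : Subgroup G)) =
      {y | x • y = y} := by
    ext y
    refine ⟨fun hy => hy ⟨x, Subgroup.mem_zpowers x⟩, fun hy => ?_⟩
    have : Subgroup.zpowers x ≤ MulAction.stabilizer G y := by simpa using hy
    exact fun z => this z.2
  rw [he] at h
  intro hd
  exact P.not_dvd_index ((h.dvd_iff (dvd_refl p)).2 hd)

theorem isPElement_of_fixed_quotient_sylow [Fact p.Prime] (P : Sylow p G) {x : G}
    {y : G ⧸ (P : Subgroup G)} (h : x • y = y) : IsPElement p x := by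
  induction y using QuotientGroup.induction_on with
  | H y =>
    have h' : y⁻¹ * x * y ∈ (P : Subgroup G) := by
      have := QuotientGroup.eq.1 h.symm
      simpa [mul_assoc] using this
    obtain ⟨k, hk⟩ := IsPGroup.iff_orderOf.1 P.isPGroup' ⟨_, h'⟩
    refine ⟨k, ?_⟩
    rw [Subgroup.orderOf_mk] at hk
    rw [← hk]
    simpa using (orderOf_injective (MulAut.conj y⁻¹).toMonoidHom (MulAut.conj y⁻¹).injective x).symm

end GroupTheory

section Characters

variable {K : Type u} [Field K]

theorem character_mem_charSet {G V : Type u} [Group G] [AddCommGroup V] [Module K V]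
    [FiniteDimensional K V] (ρ : Representation K G V) : ρ.character ∈ charSet K G :=
  ⟨FDRep.of ρ, rfl⟩

theorem exists_representation_of_mem_charSet {G : Type u} [Group G] {χ : G → K}
    (h : χ ∈ charSet K G) : ∃ (V : Type u) (_ : AddCommGroup V) (_ : Module K V)
      (_ : FiniteDimensional K V) (ρ : Representation K G V), χ = ρ.character := by
  obtain ⟨V, rfl⟩ := h
  exact ⟨V, inferInstance, inferInstance, inferInstance, V.ρ, rfl⟩

/-- An idempotent commuting with a representation cuts out a subrepresentation, whose character
is computed by composing with the idempotent. -/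
theorem trace_mul_idempotent_mem_charSet {G V : Type u} [Group G] [AddCommGroup V] [Module K V]
    [FiniteDimensional K V] (ρ : Representation K G V) (e : Module.End K V)
    (he : e * e = e) (hc : ∀ x, Commute (ρ x) e) :
    (fun x => LinearMap.trace K V (ρ x * e)) ∈ charSet K G := by
  set i := (LinearMap.range e).subtype
  set q := e.rangeRestrict
  have hiq : i ∘ₗ q = e := rfl
  have hqe : q ∘ₗ e = q := LinearMap.ext fun v => Subtype.ext (LinearMap.congr_fun he v)
  have hqi : q ∘ₗ i = LinearMap.id := by
    refine LinearMap.ext fun v => Subtype.ext ?_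
    obtain ⟨_, w, rfl⟩ := v
    exact LinearMap.congr_fun he w
  let σ : Representation K G (LinearMap.range e) :=
    { toFun := fun x => q ∘ₗ ρ x ∘ₗ i
      map_one' := by
        rw [map_one]; exact hqi
      map_mul' := fun x y => by
        have h : e ∘ₗ ρ x = ρ x ∘ₗ e := (hc x).symm.eq
        rw [map_mul]
        calc q ∘ₗ (ρ x * ρ y) ∘ₗ i = (q ∘ₗ e) ∘ₗ ρ x ∘ₗ ρ y ∘ₗ i := by rw [hqe]; rfl
          _ = q ∘ₗ (e ∘ₗ ρ x) ∘ₗ ρ y ∘ₗ i := rfl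
          _ = q ∘ₗ (ρ x ∘ₗ i ∘ₗ q) ∘ₗ ρ y ∘ₗ i := by rw [h, hiq]
          _ = _ := rfl }
  convert character_mem_charSet σ using 1
  ext x
  change _ = LinearMap.trace K _ (q ∘ₗ ρ x ∘ₗ i)
  rw [LinearMap.trace_comp_comm']
  rfl

theorem trace_pi_comp_proj {X V : Type*} [Fintype X] [AddCommGroup V] [Module K V]
    [FiniteDimensional K V] (A : X → Module.End K V) (s : X → X) :
    LinearMap.trace K (X → V) (LinearMap.pi fun x => A x ∘ₗ LinearMap.proj (s x)) =
      ∑ x, if s x = x then LinearMap.trace K V (A x) else 0 := by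
  have h : (LinearMap.pi fun x => A x ∘ₗ LinearMap.proj (s x) : Module.End K (X → V)) =
      ∑ x, LinearMap.single K (fun _ => V) x ∘ₗ (A x ∘ₗ LinearMap.proj (s x)) := by
    ext1 y; refine LinearMap.ext fun v => funext fun z => ?_
    simp [Finset.sum_apply, Pi.single_apply]
  rw [h, map_sum]
  refine Finset.sum_congr rfl fun x _ => ?_
  rw [LinearMap.trace_comp_comm']
  split_ifs with hx
  · congr 1
    rw [hx]
    ext v
    simp
  · have : (A x ∘ₗ LinearMap.proj (s x)) ∘ₗ LinearMap.single K (fun _ => V) x = 0 := by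
      ext v
      simp [hx]
    rw [this, map_zero]

theorem charSet_conj {G : Type u} [Group G] {χ : G → K} (h : χ ∈ charSet K G) (x y : G) :
    χ (y⁻¹ * x * y) = χ x := by
  obtain ⟨V, rfl⟩ := h
  simpa using V.char_conj x y⁻¹

theorem one_mem_charSet {G : Type u} [Group G] : (1 : G → K) ∈ charSet K G := by
  convert character_mem_charSet (1 : Representation K G K) using 1
  ext x
  simp [Representation.character]

theorem mul_mem_charSet {G : Type u} [Group G] {χ ψ : G → K} (hχ : χ ∈ charSet K G)
    (hψ : ψ ∈ charSet K G) : χ * ψ ∈ charSet K G := by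
  obtain ⟨V, _, _, _, ρ, rfl⟩ := exists_representation_of_mem_charSet hχ
  obtain ⟨W, _, _, _, σ, rfl⟩ := exists_representation_of_mem_charSet hψ
  rw [← Representation.char_tensor]
  exact character_mem_charSet _

theorem comp_mem_charSet {G H : Type u} [Group G] [Group H] (φ : H →* G) {χ : G → K}
    (hχ : χ ∈ charSet K G) : χ ∘ φ ∈ charSet K H := by
  obtain ⟨V, _, _, _, ρ, rfl⟩ := exists_representation_of_mem_charSet hχ
  exact character_mem_charSet (ρ.comp φ)

/-- The permutation character of a finite `G`-set. -/
theorem card_fixed_mem_charSet {G X : Type u} [Group G] [MulAction G X] [Finite X] :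
    (fun x : G => (Nat.card {y : X // x • y = y} : K)) ∈ charSet K G := by
  have := Fintype.ofFinite X
  let ρ : Representation K G (X → K) :=
    { toFun := fun x => LinearMap.pi fun y => LinearMap.id ∘ₗ LinearMap.proj (x⁻¹ • y)
      map_one' := by ext1 y; refine LinearMap.ext fun v => funext fun z => ?_; simp
      map_mul' := fun x x' => by
        ext1 y; refine LinearMap.ext fun v => funext fun z => ?_; simp [mul_smul] }
  convert character_mem_charSet ρ using 1
  ext x
  refine Eq.trans ?_ (trace_pi_comp_proj (fun _ => LinearMap.id) (fun y => x⁻¹ • y)).symm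
  simp [Nat.card_eq_fintype_card, Fintype.card_subtype, inv_smul_eq_iff, eq_comm (a := x • _)]

/-- Induction of class functions, as a linear map. -/
noncomputable def indLinearMap (K : Type*) [Field K] {G : Type*} [Group G] [Fintype G]
    (H : Subgroup G) : (H → K) →ₗ[K] (G → K) where
  toFun u x := (Nat.card H : K)⁻¹ *
    ∑ y : G, if hy : y⁻¹ * x * y ∈ H then u ⟨y⁻¹ * x * y, hy⟩ else 0
  map_add' u v := by
    ext x
    simp only [Pi.add_apply, ← mul_add, ← Finset.sum_add_distrib]
    congr 2 with y
    split_ifs <;> simp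
  map_smul' c u := by
    ext x
    simp only [Pi.smul_apply, smul_eq_mul, RingHom.id_apply, mul_left_comm c]
    congr 1
    rw [Finset.mul_sum]
    congr 1 with y
    split_ifs <;> simp

theorem indLinearMap_mem_charSet [CharZero K] {G : Type u} [Group G] [Fintype G]
    (H : Subgroup G) {χ : H → K} (hχ : χ ∈ charSet K H) :
    indLinearMap K H χ ∈ charSet K G := by
  obtain ⟨V, _, _, _, ρ, rfl⟩ := exists_representation_of_mem_charSet hχ
  let R : Representation K G (G → V) :=
    { toFun := fun x => LinearMap.pi fun y => LinearMap.id ∘ₗ LinearMap.proj (x⁻¹ * y)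
      map_one' := by ext1 y; refine LinearMap.ext fun v => funext fun z => ?_; simp
      map_mul' := fun x x' => by
        ext1 y; refine LinearMap.ext fun v => funext fun z => ?_; simp [mul_assoc] }
  let L : Representation K H (G → V) :=
    { toFun := fun h => LinearMap.pi fun y => ρ h ∘ₗ LinearMap.proj (y * h)
      map_one' := by ext1 y; refine LinearMap.ext fun v => funext fun z => ?_; simp
      map_mul' := fun x x' => by
        ext1 y; refine LinearMap.ext fun v => funext fun z => ?_; simp [mul_assoc] }
  have : Invertible (Nat.card H : K) :=
    invertibleOfNonzero (Nat.cast_ne_zero.2 Nat.card_pos.ne')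
  have hLe : L.averageMap = (Nat.card H : K)⁻¹ • ∑ h : H, L h := by
    have : Invertible (Fintype.card H : K) := by rw [Fintype.card_eq_nat_card]; assumption
    simp [Representation.averageMap, GroupAlgebra.average, map_sum]
  have hRL : ∀ x h, Commute (R x) (L h) := fun x h => by
    refine LinearMap.ext fun v => funext fun z => ?_
    simp [R, L, mul_assoc]
  convert trace_mul_idempotent_mem_charSet R L.averageMap
    (Representation.isProj_averageMap L).isIdempotentElem (fun x => ?_) using 1
  · ext x
    rw [hLe, mul_smul_comm, Finset.mul_sum, map_smul, map_sum, smul_eq_mul]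
    change (Nat.card H : K)⁻¹ * _ = _
    congr 1
    have h1 : ∀ h : H, LinearMap.trace K (G → V) (R x * L h) =
        ∑ y : G, if x⁻¹ * y * h = y then ρ.character h else 0 := fun h => by
      refine Eq.trans ?_ (trace_pi_comp_proj (fun _ => ρ h) (fun y => x⁻¹ * y * (h : G)))
      congr 1
    simp_rw [h1]
    rw [Finset.sum_comm]
    refine Finset.sum_congr rfl fun y _ => ?_
    have h2 : ∀ h : H, x⁻¹ * y * h = y ↔ (h : G) = y⁻¹ * x * y := fun h => by
      rw [← eq_inv_mul_iff_mul_eq, mul_inv_rev, inv_inv]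
    simp_rw [h2]
    split_ifs with hy
    · rw [Finset.sum_eq_single ⟨_, hy⟩]
      · simp
      · intro h _ hne
        rw [if_neg fun e => hne (Subtype.ext e)]
      · simp
    · exact (Finset.sum_eq_zero fun (h : H) _ =>
        if_neg fun (e : (h : G) = y⁻¹ * x * y) => hy (e ▸ h.property)).symm
  · rw [hLe]
    exact (Commute.sum_right _ _ _ fun h _ => hRL x h).smul_right _

end Characters

section Translation

variable {K : Type u} [Field K]

/-- If `u ^ n = 1`, then averaging the powers of `u` gives an idempotent fixed by `u`. -/
theorem geom_average_fixed {A : Type*} [Ring A] [Algebra K A] [CharZero K] {u : A} {n : ℕ}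
    (hn : n ≠ 0) (hu : u ^ n = 1) :
    let e := (n : K)⁻¹ • ∑ j ∈ Finset.range n, u ^ j
    u * e = e ∧ e * e = e := by
  intro e
  have h : u * e = e := by
    have := mul_geom_sum u n
    rw [hu, sub_self, sub_mul, one_mul, sub_eq_zero] at this
    simp only [e, mul_smul_comm, this]
  refine ⟨h, ?_⟩
  have hj : ∀ j : ℕ, u ^ j * e = e := fun j => by
    induction j with
    | zero => simp
    | succ j ih => rw [pow_succ, mul_assoc, h, ih]
  have hn' : (n : K) ≠ 0 := Nat.cast_ne_zero.2 hn
  change ((n : K)⁻¹ • ∑ j ∈ Finset.range n, u ^ j) * e = e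
  rw [smul_mul_assoc, Finset.sum_mul, Finset.sum_congr rfl fun j _ => hj j, Finset.sum_const,
    Finset.card_range, ← Nat.cast_smul_eq_nsmul K, smul_smul, inv_mul_cancel₀ hn', one_smul]

/-- The translate of a character by a central element of order `n` is a combination of characters
with `n`-th roots of unity as coefficients. -/
theorem translate_charSet_eq_sum [CharZero K] {G : Type u} [Group G] {χ : G → K}
    (hχ : χ ∈ charSet K G) {z : G} (hz : ∀ x, Commute z x) {n : ℕ} (hn : n ≠ 0)
    (hzn : z ^ n = 1) {η : K} (hη : IsPrimitiveRoot η n) :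
    ∃ ψ : ℕ → G → K, (∀ i, ψ i ∈ charSet K G) ∧
      (fun x => χ (z * x)) = ∑ i ∈ Finset.range n, η ^ i • ψ i := by
  obtain ⟨V, _, _, _, ρ, rfl⟩ := exists_representation_of_mem_charSet hχ
  have hη0 : η ≠ 0 := hη.ne_zero hn
  let u : ℕ → Module.End K V := fun i => (η ^ i)⁻¹ • ρ z
  let e : ℕ → Module.End K V := fun i => (n : K)⁻¹ • ∑ j ∈ Finset.range n, u i ^ j
  have hu : ∀ i, u i ^ n = 1 := fun i => by
    simp only [u, smul_pow, ← map_pow, hzn, map_one]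
    rw [inv_pow, ← pow_mul, mul_comm, pow_mul, hη.pow_eq_one, one_pow, inv_one, one_smul]
  have he : ∀ i, u i * e i = e i ∧ e i * e i = e i := fun i => geom_average_fixed hn (hu i)
  have hze : ∀ i, ρ z * e i = η ^ i • e i := fun i => by
    conv_rhs => rw [← (he i).1]
    simp only [u, smul_mul_assoc, smul_smul, mul_inv_cancel₀ (pow_ne_zero i hη0), one_smul]
  have hsum : ∑ i ∈ Finset.range n, e i = 1 := by
    have h1 : ∀ i j, u i ^ j = ((η⁻¹) ^ j) ^ i • ρ z ^ j := fun i j => by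
      simp only [u, smul_pow]
      congr 1
      rw [← inv_pow, ← pow_mul, ← pow_mul, mul_comm]
    simp only [e, h1]
    rw [← Finset.smul_sum, Finset.sum_comm, Finset.sum_eq_single 0]
    · simp [← Nat.cast_smul_eq_nsmul K, smul_smul, hn]
    · intro j hj hj0
      rw [← Finset.sum_smul]
      have h2 : (η⁻¹) ^ j ≠ 1 :=
        hη.inv.pow_ne_one_of_pos_of_lt hj0 (Finset.mem_range.1 hj)
      have h3 := mul_geom_sum ((η⁻¹) ^ j) n
      rw [← pow_mul, mul_comm j n, pow_mul, hη.inv.pow_eq_one, one_pow, sub_self] at h3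
      rw [(mul_eq_zero.1 h3).resolve_left (sub_ne_zero.2 h2), zero_smul]
    · simp [hn]
  have hcz : ∀ x, Commute (ρ x) (ρ z) := fun x => (hz x).symm.map ρ
  refine ⟨fun i x => LinearMap.trace K V (ρ x * e i), fun i =>
    trace_mul_idempotent_mem_charSet ρ (e i) (he i).2 fun x => ?_, ?_⟩
  · exact (Commute.sum_right _ _ _ fun j _ =>
      ((hcz x).smul_right _).pow_right j).smul_right _
  · ext x
    simp only [Finset.sum_apply, Pi.smul_apply, ← map_smul, ← map_sum]
    change LinearMap.trace K V (ρ (z * x)) = _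
    congr 1
    rw [map_mul, ← (hcz x).eq, ← mul_one (ρ x * ρ z), ← hsum, Finset.mul_sum]
    refine Finset.sum_congr rfl fun i _ => ?_
    rw [mul_assoc, hze, mul_smul_comm]

end Translation

section LocCharRing

variable {𝒪 : Type*} [CommRing 𝒪] {K : Type u} [Field K] [Algebra 𝒪 K] {𝔭 : Ideal 𝒪}
  {G H : Type u} [Group G] [Group H]

theorem mul_mem_locSet [𝔭.IsPrime] {x y : K} (hx : x ∈ locSet 𝒪 K 𝔭) (hy : y ∈ locSet 𝒪 K 𝔭) :
    x * y ∈ locSet 𝒪 K 𝔭 := by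
  obtain ⟨a, b, hb, h⟩ := hx
  obtain ⟨c, d, hd, h'⟩ := hy
  refine ⟨a * c, b * d, fun hm => (‹𝔭.IsPrime›.mem_or_mem hm).elim hb hd, ?_⟩
  rw [map_mul, map_mul, ← h, ← h']
  ring

theorem algebraMap_mem_locSet [𝔭.IsPrime] (a : 𝒪) : algebraMap 𝒪 K a ∈ locSet 𝒪 K 𝔭 :=
  ⟨a, 1, (Ideal.ne_top_iff_one 𝔭).1 ‹𝔭.IsPrime›.ne_top, by simp⟩

/-- The inverse of an integer prime to the residue characteristic lies in `𝒪_𝔭`. -/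
theorem inv_natCast_mem_locSet [CharZero K] [𝔭.IsPrime] {p : ℕ} (hp : p.Prime) (hp𝔭 : (p : 𝒪) ∈ 𝔭)
    {m : ℕ} (hm : ¬ p ∣ m) : (m : K)⁻¹ ∈ locSet 𝒪 K 𝔭 := by
  refine ⟨1, m, fun h => ‹𝔭.IsPrime›.ne_top ((Ideal.eq_top_iff_one 𝔭).2 ?_), ?_⟩
  · have hc : IsCoprime (p : ℤ) (m : ℤ) := Nat.isCoprime_iff_coprime.2 (hp.coprime_iff_not_dvd.2 hm)
    obtain ⟨a, b, hab⟩ := hc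
    have : (a : 𝒪) * p + b * m = 1 := by exact_mod_cast congrArg (Int.cast : ℤ → 𝒪) hab
    rw [← this]
    exact 𝔭.add_mem (𝔭.mul_mem_left _ hp𝔭) (𝔭.mul_mem_left _ h)
  · have : (m : K) ≠ 0 := Nat.cast_ne_zero.2 fun h0 => hm (h0 ▸ dvd_zero p)
    simp [this]

theorem mem_locSet_of_pow_eq_one [IsDomain 𝒪] [IsIntegrallyClosed 𝒪] [IsFractionRing 𝒪 K]
    [𝔭.IsPrime] {x : K} {n : ℕ} (hn : n ≠ 0) (hx : x ^ n = 1) : x ∈ locSet 𝒪 K 𝔭 := by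
  have h : IsIntegral 𝒪 x := IsIntegral.of_pow (Nat.pos_of_ne_zero hn) (hx ▸ isIntegral_one)
  obtain ⟨a, rfl⟩ := IsIntegrallyClosed.algebraMap_eq_of_integral h
  exact algebraMap_mem_locSet a

theorem const_mem_locCharRing {c : K} (hc : c ∈ locSet 𝒪 K 𝔭) :
    Function.const G c ∈ locCharRing 𝒪 K 𝔭 G :=
  Subring.subset_closure (Or.inl ⟨c, hc, rfl⟩)

theorem smul_mem_locCharRing {c : K} (hc : c ∈ locSet 𝒪 K 𝔭) {f : G → K}
    (hf : f ∈ locCharRing 𝒪 K 𝔭 G) : c • f ∈ locCharRing 𝒪 K 𝔭 G :=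
  (locCharRing 𝒪 K 𝔭 G).mul_mem (const_mem_locCharRing hc) hf

theorem charSet_subset_locCharRing : charSet K G ⊆ locCharRing 𝒪 K 𝔭 G :=
  fun _ h => Subring.subset_closure (Or.inr h)

/-- Elements of `𝒪_𝔭R(G)` are sums of characters with coefficients in `𝒪_𝔭`. -/
theorem locCharRing_mem_addClosure [𝔭.IsPrime] {f : G → K} (hf : f ∈ locCharRing 𝒪 K 𝔭 G) :
    f ∈ AddSubgroup.closure {f : G → K | ∃ c ∈ locSet 𝒪 K 𝔭, ∃ χ ∈ charSet K G, f = c • χ} := by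
  let S : Submonoid (G → K) :=
    { carrier := {f : G → K | ∃ c ∈ locSet 𝒪 K 𝔭, ∃ χ ∈ charSet K G, f = c • χ}
      one_mem' := ⟨1, by simpa using algebraMap_mem_locSet (K := K) (𝔭 := 𝔭) 1, 1,
        one_mem_charSet, by simp⟩
      mul_mem' := by
        rintro _ _ ⟨c, hc, χ, hχ, rfl⟩ ⟨d, hd, ψ, hψ, rfl⟩
        exact ⟨c * d, mul_mem_locSet hc hd, χ * ψ, mul_mem_charSet hχ hψ, by
          rw [smul_mul_smul_comm]⟩ }
  refine AddSubgroup.closure_mono ?_ (Subring.mem_closure_iff.1 hf)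
  change Submonoid.closure _ ≤ S
  rw [Submonoid.closure_le]
  rintro _ (⟨c, hc, rfl⟩ | hχ)
  · exact ⟨c, hc, 1, one_mem_charSet, by ext; simp⟩
  · exact ⟨1, by simpa using algebraMap_mem_locSet (K := K) (𝔭 := 𝔭) 1, _, hχ, by simp⟩

/-- A linear map sending characters into `𝒪_𝔭R(G)` maps `𝒪_𝔭R(H)` into `𝒪_𝔭R(G)`. -/
theorem map_mem_locCharRing [𝔭.IsPrime] (Φ : (H → K) →ₗ[K] (G → K))
    (h : ∀ χ ∈ charSet K H, Φ χ ∈ locCharRing 𝒪 K 𝔭 G) {f : H → K}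
    (hf : f ∈ locCharRing 𝒪 K 𝔭 H) : Φ f ∈ locCharRing 𝒪 K 𝔭 G := by
  suffices h' : AddSubgroup.closure {f : H → K | ∃ c ∈ locSet 𝒪 K 𝔭, ∃ χ ∈ charSet K H, f = c • χ} ≤
      (locCharRing 𝒪 K 𝔭 G).toAddSubgroup.comap Φ.toAddMonoidHom from
    h' (locCharRing_mem_addClosure hf)
  rw [AddSubgroup.closure_le]
  rintro _ ⟨c, hc, χ, hχ, rfl⟩
  change Φ (c • χ) ∈ locCharRing 𝒪 K 𝔭 G
  rw [map_smul]
  exact smul_mem_locCharRing hc (h χ hχ)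

theorem locCharRing_conj {f : G → K} (hf : f ∈ locCharRing 𝒪 K 𝔭 G) (x y : G) :
    f (y⁻¹ * x * y) = f x := by
  induction hf using Subring.closure_induction with
  | mem f hf =>
    obtain ⟨c, _, rfl⟩ | hf := hf
    · rfl
    · exact charSet_conj hf x y
  | zero => rfl
  | one => rfl
  | add _ _ _ _ h h' => simp [h, h']
  | neg _ _ h => simp [h]
  | mul _ _ _ _ h h' => simp [h, h']

/-- The indicator function of the set of `p`-elements belongs to `𝒪_𝔭R(G)`. -/
theorem eFun_one_mem_locCharRing [CharZero K] [𝔭.IsPrime] [Finite G] {p : ℕ} [Fact p.Prime]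
    (hp : (p : 𝒪) ∈ 𝔭) : eFun p K (1 : G) ∈ locCharRing 𝒪 K 𝔭 G := by
  have := Fintype.ofFinite G
  obtain ⟨P⟩ : Nonempty (Sylow p G) := inferInstance
  let n : G → ℕ := fun x => Nat.card {y : G ⧸ (P : Subgroup G) // x • y = y}
  let φ : G → K := fun x => n x
  have hφ : φ ∈ locCharRing 𝒪 K 𝔭 G := charSet_subset_locCharRing card_fixed_mem_charSet
  have hn : ∀ x, IsPElement p x → ¬ p ∣ n x :=
    fun x hx => not_dvd_card_fixed_quotient_sylow P hx
  have hn0 : ∀ x, ¬ IsPElement p x → n x = 0 := fun x hx => by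
    have : IsEmpty {y : G ⧸ (P : Subgroup G) // x • y = y} :=
      ⟨fun y => hx (isPElement_of_fixed_quotient_sylow P y.2)⟩
    exact Nat.card_of_isEmpty
  have h : eFun p K (1 : G) =
      1 - ∏ x ∈ Finset.univ.filter (IsPElement p (G := G)), (1 - (n x : K)⁻¹ • φ) := by
    ext z
    rw [eFun_one_apply, Pi.sub_apply, Finset.prod_apply]
    split_ifs with hz
    · have hz0 : (n z : K) ≠ 0 := Nat.cast_ne_zero.2 fun h0 => hn z hz (h0 ▸ dvd_zero p)
      rw [Finset.prod_eq_zero (i := z) (by simpa using hz) (by simp [φ, hz0])]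
      simp
    · rw [Finset.prod_eq_one fun x _ => by simp [φ, hn0 z hz]]
      simp
  rw [h]
  refine Subring.sub_mem _ (Subring.one_mem _) (Subring.prod_mem _ fun x hx => ?_)
  exact Subring.sub_mem _ (Subring.one_mem _) (smul_mem_locCharRing
    (inv_natCast_mem_locSet Fact.out hp (hn x (Finset.mem_filter.1 hx).2)) hφ)

theorem comp_mem_locCharRing [𝔭.IsPrime] (φ : H →* G) {f : G → K}
    (hf : f ∈ locCharRing 𝒪 K 𝔭 G) : f ∘ φ ∈ locCharRing 𝒪 K 𝔭 H :=
  map_mem_locCharRing (LinearMap.funLeft K K φ)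
    (fun _ h => charSet_subset_locCharRing (comp_mem_charSet φ h)) hf

/-- Translation by a central element preserves `𝒪_𝔭R(G)`. -/
theorem translate_mem_locCharRing [IsDomain 𝒪] [IsIntegrallyClosed 𝒪] [IsFractionRing 𝒪 K]
    [CharZero K] [𝔭.IsPrime] {z : G} (hz : ∀ x, Commute z x) {n : ℕ} (hn : n ≠ 0)
    (hzn : z ^ n = 1) {η : K} (hη : IsPrimitiveRoot η n) {f : G → K}
    (hf : f ∈ locCharRing 𝒪 K 𝔭 G) : (fun x => f (z * x)) ∈ locCharRing 𝒪 K 𝔭 G := by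
  refine map_mem_locCharRing (LinearMap.funLeft K K (z * ·)) (fun χ hχ => ?_) hf
  obtain ⟨ψ, hψ, h⟩ := translate_charSet_eq_sum hχ hz hn hzn hη
  change (fun x => χ (z * x)) ∈ _
  rw [h]
  refine Subring.sum_mem _ fun i _ => smul_mem_locCharRing
    (mem_locSet_of_pow_eq_one hn ?_) (charSet_subset_locCharRing (hψ i))
  rw [← pow_mul, mul_comm, pow_mul, hη.pow_eq_one, one_pow]

end LocCharRing

section ResInd

variable {p : ℕ} {K : Type u} [Field K] {G : Type u} [Group G]

theorem commute_of_mem_centralizer_singleton {g : G} (h : Subgroup.centralizer ({g} : Set G)) :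
    Commute g h :=
  (Subgroup.mem_centralizer_singleton_iff.1 h.2).symm

/-- If `h` has `p'`-part `g`, its conjugates with `p'`-part `g` are those by elements of the
centralizer of `g`. -/
theorem pPrimePart_conj_eq_iff {g h : G}
    (hh : pPrimePart p h = g) (y : G) :
    pPrimePart p (y⁻¹ * h * y) = g ↔ y ∈ Subgroup.centralizer ({g} : Set G) := by
  rw [pPrimePart_conj, hh, Subgroup.mem_centralizer_singleton_iff, mul_assoc, inv_mul_eq_iff_eq_mul]
  exact eq_comm

variable [Fact p.Prime] [Fintype G]

/-- On functions supported on `p`-elements, `ind_g` only sees the conjugates with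
`p'`-part `g`. -/
theorem indFun_eq_of_support {g : G} (hg : IsPRegular p g)
    {f : Subgroup.centralizer ({g} : Set G) → K}
    (hf : ∀ h, ¬ IsPElement p h → f h = 0) (x : G) :
    indFun K g f x = (Nat.card (Subgroup.centralizer ({g} : Set G)) : K)⁻¹ *
      ∑ y : G, if hy : pPrimePart p (y⁻¹ * x * y) = g then
        f ⟨g⁻¹ * (y⁻¹ * x * y), Subgroup.mul_mem _ (Subgroup.inv_mem _
          (Subgroup.mem_centralizer_singleton_iff.2 rfl)) ((pPrimePart_eq_iff hg _).1 hy).1⟩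
        else 0 := by
  unfold indFun
  congr 1
  refine Finset.sum_congr rfl fun y _ => ?_
  by_cases hy : pPrimePart p (y⁻¹ * x * y) = g
  · have h1 := ((pPrimePart_eq_iff hg _).1 hy).1
    have h2 : g⁻¹ * (y⁻¹ * x * y) ∈ Subgroup.centralizer ({g} : Set G) :=
      Subgroup.mul_mem _ (Subgroup.inv_mem _ (Subgroup.mem_centralizer_singleton_iff.2 rfl)) h1
    rw [dif_pos h1, dif_pos h2, dif_pos hy]
  · rw [dif_neg hy]
    split_ifs with h1 h2
    · refine hf _ fun h => hy ((pPrimePart_eq_iff hg _).2 ⟨h1, (isPElement_coe _).2 h⟩)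
    · rfl
    · rfl

theorem indFun_eq_indLinearMap (g : G) (f : Subgroup.centralizer ({g} : Set G) → K) :
    indFun K g f = indLinearMap K (Subgroup.centralizer ({g} : Set G))
      fun x => f (⟨g, Subgroup.mem_centralizer_singleton_iff.2 rfl⟩⁻¹ * x) := by
  ext x
  change _ = (Nat.card _ : K)⁻¹ * _
  unfold indFun
  congr 1
  refine Finset.sum_congr rfl fun y _ => ?_
  split_ifs with h1 h2
  · rfl
  · exact absurd (Subgroup.mul_mem _ (Subgroup.inv_mem _
      (Subgroup.mem_centralizer_singleton_iff.2 rfl)) h1) h2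
  · rfl

theorem eq_zero_of_mul_eFun_one {g : G} {f : Subgroup.centralizer ({g} : Set G) → K}
    (hf : f * eFun p K (1 : Subgroup.centralizer ({g} : Set G)) = f)
    (h : Subgroup.centralizer ({g} : Set G)) (hh : ¬ IsPElement p h) : f h = 0 := by
  rw [← hf, Pi.mul_apply, eFun_one_apply, if_neg hh, mul_zero]

theorem resFun_mul_eFun_one (g : G) (f : G → K) :
    resFun p K g f * eFun p K (1 : Subgroup.centralizer ({g} : Set G)) = resFun p K g f := by
  ext h
  rw [Pi.mul_apply, eFun_one_apply, ← isPElement_coe]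
  unfold resFun
  split_ifs <;> simp

theorem indFun_mul_eFun {g : G} (hg : IsPRegular p g)
    {f : Subgroup.centralizer ({g} : Set G) → K} (hf : ∀ h, ¬ IsPElement p h → f h = 0) :
    indFun K g f * eFun p K g = indFun K g f := by
  ext x
  rw [Pi.mul_apply]
  unfold eFun
  split_ifs with hx
  · rw [mul_one]
  · rw [mul_zero, indFun_eq_of_support hg hf, Finset.sum_eq_zero, mul_zero]
    intro y _
    refine dif_neg fun hy => hx ?_
    rw [pPrimePart_conj] at hy
    exact (isConj_iff.2 ⟨y⁻¹, by rw [inv_inv, hy]⟩).symm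

theorem resFun_eFun {g : G} (hg : IsPRegular p g) :
    resFun p K g (eFun p K g) = eFun p K (1 : Subgroup.centralizer ({g} : Set G)) := by
  ext h
  rw [eFun_one_apply, ← isPElement_coe]
  unfold resFun
  split_ifs with hh
  · rw [eFun, pPrimePart_mul (commute_of_mem_centralizer_singleton h) hg (orderOf_pos g).ne' hh,
      if_pos (IsConj.refl g)]
  · rfl

theorem sum_ite_mem_subgroup (H : Subgroup G) (c : K) :
    ∑ y : G, (if y ∈ H then c else 0) = Nat.card H * c := by
  rw [← Finset.sum_filter, Finset.sum_const, nsmul_eq_mul, ← Fintype.card_subtype,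
    ← Nat.card_eq_fintype_card]

theorem resFun_indFun [CharZero K] {g : G} (hg : IsPRegular p g)
    {f : Subgroup.centralizer ({g} : Set G) → K} (hf : ∀ h, ¬ IsPElement p h → f h = 0)
    (hc : ∀ x y, f (y⁻¹ * x * y) = f x) : resFun p K g (indFun K g f) = f := by
  ext h
  unfold resFun
  split_ifs with hh
  · have hgh := pPrimePart_mul (commute_of_mem_centralizer_singleton h) hg (orderOf_pos g).ne' hh
    have hcard : (Nat.card (Subgroup.centralizer ({g} : Set G)) : K) ≠ 0 :=
      Nat.cast_ne_zero.2 Nat.card_pos.ne'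
    rw [indFun_eq_of_support hg hf, inv_mul_eq_iff_eq_mul₀ hcard, ← sum_ite_mem_subgroup]
    refine Finset.sum_congr rfl fun y _ => ?_
    have hiff := pPrimePart_conj_eq_iff hgh y
    split_ifs with h1 h2 h2
    · rw [← hc h ⟨y, h2⟩]
      congr 1
      ext
      have hy : g * y = y * g := commute_of_mem_centralizer_singleton ⟨y, h2⟩
      change g⁻¹ * (y⁻¹ * (g * h) * y) = y⁻¹ * h * y
      have hy' : g⁻¹ * y⁻¹ = y⁻¹ * g⁻¹ := by rw [← mul_inv_rev, ← hy, mul_inv_rev]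
      simp only [← mul_assoc, hy', inv_mul_cancel_right]
    · exact absurd (hiff.1 h1) h2
    · exact absurd (hiff.2 h2) h1
    · rfl
  · exact (hf h fun h' => hh ((isPElement_coe h).2 h')).symm

theorem indFun_resFun [CharZero K] {g : G} (hg : IsPRegular p g) {f : G → K}
    (hf : f * eFun p K g = f) (hc : ∀ x y, f (y⁻¹ * x * y) = f x) :
    indFun K g (resFun p K g f) = f := by
  have hs := eq_zero_of_mul_eFun_one (resFun_mul_eFun_one (p := p) g f)
  have hcard : (Nat.card (Subgroup.centralizer ({g} : Set G)) : K) ≠ 0 :=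
    Nat.cast_ne_zero.2 Nat.card_pos.ne'
  ext x
  by_cases hx : IsConj g (pPrimePart p x)
  · obtain ⟨k, hk⟩ := isConj_iff.1 hx
    have hk' : pPrimePart p (k⁻¹ * x * k) = g := by
      rw [pPrimePart_conj, ← hk]; group
    rw [indFun_eq_of_support hg hs, inv_mul_eq_iff_eq_mul₀ hcard, ← sum_ite_mem_subgroup,
      ← Equiv.sum_comp (Equiv.mulLeft k)]
    refine Finset.sum_congr rfl fun y _ => ?_
    have hy : (k * y)⁻¹ * x * (k * y) = y⁻¹ * (k⁻¹ * x * k) * y := by group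
    have hiff := pPrimePart_conj_eq_iff hk' y
    rw [← hy] at hiff
    by_cases h1 : y ∈ Subgroup.centralizer ({g} : Set G)
    · have h2 := hiff.2 h1
      rw [if_pos h1]
      refine (dif_pos h2).trans ?_
      refine (if_pos ((pPrimePart_eq_iff hg _).1 h2).2).trans ?_
      exact (congrArg f (mul_inv_cancel_left g _)).trans (hc x (k * y))
    · rw [if_neg h1]
      exact dif_neg fun h2 => h1 (hiff.1 h2)
  · have h0 : eFun p K g x = 0 := if_neg hx
    rw [← indFun_mul_eFun hg hs, Pi.mul_apply, h0, mul_zero, ← hf, Pi.mul_apply, h0, mul_zero]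

end ResInd

variable {𝒪 : Type*} [CommRing 𝒪] [IsDomain 𝒪] [IsDedekindDomain 𝒪] [CharZero 𝒪]
variable {K : Type u} [Field K] [Algebra 𝒪 K] [IsFractionRing 𝒪 K]
variable {𝔭 : Ideal 𝒪} [𝔭.IsMaximal]

/-- For a `p`-regular `g ∈ G` with centralizer `H = C_G(g)`, the maps `res_g`
and `ind_g` are well defined and are mutually inverse isomorphisms of `𝒪_𝔭`-algebras between
the blocks `R_𝔭(G,C) = 𝒪_𝔭R(G)·e_C` and `R_𝔭(H,1) = 𝒪_𝔭R(H)·e_1`  (an element of the block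
is an `f` in the ring with `f·e = f`; `res_g` is additive, multiplicative, sends the identity
`e_C` to `e_1`, commutes with the `𝒪_𝔭`-scalars, and is inverse to `ind_g`). -/
theorem res_ind_mutually_inverse_algebra_isos
    (p : ℕ) [Fact p.Prime] (hp : (p : 𝒪) ∈ 𝔭)
    {G : Type u} [Group G] [Fintype G]
    (ζ : K) (hζ : IsPrimitiveRoot ζ (Nat.card G))
    (g : G) (hg : IsPRegular p g) :
    (∀ f : G → K, f ∈ locCharRing 𝒪 K 𝔭 G → f * eFun p K g = f →
        resFun p K g f ∈ locCharRing 𝒪 K 𝔭 (Subgroup.centralizer ({g} : Set G)) ∧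
        resFun p K g f * eFun p K (1 : Subgroup.centralizer ({g} : Set G)) =
          resFun p K g f) ∧
    (∀ f : Subgroup.centralizer ({g} : Set G) → K,
        f ∈ locCharRing 𝒪 K 𝔭 (Subgroup.centralizer ({g} : Set G)) →
        f * eFun p K (1 : Subgroup.centralizer ({g} : Set G)) = f →
        indFun K g f ∈ locCharRing 𝒪 K 𝔭 G ∧ indFun K g f * eFun p K g = indFun K g f) ∧
    (∀ f₁ f₂ : G → K, resFun p K g (f₁ + f₂) = resFun p K g f₁ + resFun p K g f₂) ∧
    (∀ f₁ f₂ : G → K, resFun p K g (f₁ * f₂) = resFun p K g f₁ * resFun p K g f₂) ∧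
    resFun p K g (eFun p K g) = eFun p K (1 : Subgroup.centralizer ({g} : Set G)) ∧
    (∀ c ∈ locSet 𝒪 K 𝔭, ∀ f : G → K,
        resFun p K g (Function.const G c * f) =
          Function.const (Subgroup.centralizer ({g} : Set G)) c * resFun p K g f) ∧
    (∀ f : G → K, f ∈ locCharRing 𝒪 K 𝔭 G → f * eFun p K g = f →
        indFun K g (resFun p K g f) = f) ∧
    (∀ f : Subgroup.centralizer ({g} : Set G) → K,
        f ∈ locCharRing 𝒪 K 𝔭 (Subgroup.centralizer ({g} : Set G)) →
        f * eFun p K (1 : Subgroup.centralizer ({g} : Set G)) = f →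
        resFun p K g (indFun K g f) = f) := by
  have : CharZero K := charZero_of_injective_algebraMap (IsFractionRing.injective 𝒪 K)
  have : 𝔭.IsPrime := Ideal.IsMaximal.isPrime ‹_›
  have hcl : ∀ f : Subgroup.centralizer ({g} : Set G) → K,
      f * eFun p K (1 : Subgroup.centralizer ({g} : Set G)) = f →
        ∀ h, ¬ IsPElement p h → f h = 0 := fun f hf => eq_zero_of_mul_eFun_one hf
  let z : Subgroup.centralizer ({g} : Set G) := ⟨g, Subgroup.mem_centralizer_singleton_iff.2 rfl⟩
  have hz : ∀ x, Commute z x := fun x => Subtype.ext (commute_of_mem_centralizer_singleton x)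
  have hn : Nat.card G ≠ 0 := Nat.card_pos.ne'
  have hzn : z ^ Nat.card G = 1 := Subtype.ext (pow_card_eq_one' (x := g))
  refine ⟨fun f hf _ => ⟨?_, resFun_mul_eFun_one g f⟩, fun f hf hf' =>
    ⟨?_, indFun_mul_eFun hg (hcl f hf')⟩, fun f₁ f₂ => ?_, fun f₁ f₂ => ?_, resFun_eFun hg,
    fun c _ f => ?_, fun f hf hf' => indFun_resFun hg hf' (locCharRing_conj hf),
    fun f hf hf' => resFun_indFun hg (hcl f hf') (locCharRing_conj hf)⟩
  · have h : resFun p K g f = (fun x => (f ∘ (Subgroup.centralizer ({g} : Set G)).subtype) (z * x)) *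
        eFun p K (1 : Subgroup.centralizer ({g} : Set G)) := by
      ext h
      rw [Pi.mul_apply, eFun_one_apply, ← isPElement_coe, mul_ite, mul_one, mul_zero]
      rfl
    rw [h]
    exact Subring.mul_mem _ (translate_mem_locCharRing hz hn hzn hζ (comp_mem_locCharRing _ hf))
      (eFun_one_mem_locCharRing hp)
  · rw [indFun_eq_indLinearMap]
    refine map_mem_locCharRing _
      (fun χ hχ => charSet_subset_locCharRing (indLinearMap_mem_charSet _ hχ)) ?_
    exact translate_mem_locCharRing (fun x => (hz x).inv_left) hn
      (by rw [inv_pow, hzn, inv_one]) hζ hf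
  all_goals
    ext h
    simp only [resFun, Pi.add_apply, Pi.mul_apply, Function.const_apply]
    split_ifs <;> simp
end

section
/- Let H be a subgroup of G whose index [G:H] is prime to p. Then restriction of class functions from G to H maps R_𝔭(G,1) into R_𝔭(H,1), and this map is an injective homomorphism of 𝒪_𝔭-algebras whose image is a direct summand of the 𝒪_𝔭-module R_𝔭(H,1) (a split injection of 𝒪_𝔭-modules). Consequently the induced map kR_𝔭(G,1) → kR_𝔭(H,1) is an injective k-algebra homomorphism, and ℓ_p(G,1) ≤ ℓ_p(H,1). -/
open scoped TensorProduct Classical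

/-- The canonical embedding of the localization `𝒪_𝔭` into the fraction field `K`. -/
noncomputable def locToK (𝒪 K : Type*) [CommRing 𝒪] [IsDomain 𝒪] [Field K] [Algebra 𝒪 K]
    [IsFractionRing 𝒪 K] (𝔭 : Ideal 𝒪) [𝔭.IsPrime] : Localization.AtPrime 𝔭 →+* K :=
  IsLocalization.lift (M := 𝔭.primeCompl) (g := algebraMap 𝒪 K)
    (fun y => isUnit_iff_ne_zero.mpr (fun h => y.2 (by
      have h0 : (y : 𝒪) = 0 := IsFractionRing.injective 𝒪 K (by simpa using h)
      rw [h0]; exact 𝔭.zero_mem)))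

/-- Class functions `G → K` as a module over the localization `𝒪_𝔭`, through the canonical
embedding `𝒪_𝔭 → K`. -/
noncomputable def locModule (𝒪 : Type*) (K : Type u) [CommRing 𝒪] [IsDomain 𝒪] [Field K]
    [Algebra 𝒪 K] [IsFractionRing 𝒪 K] (𝔭 : Ideal 𝒪) [𝔭.IsPrime] (G : Type u) :
    Module (Localization.AtPrime 𝔭) (G → K) :=
  Module.compHom _ (locToK 𝒪 K 𝔭)

/-- The rank over `𝒪_𝔭` of the block `R_𝔭(G, C) = 𝒪_𝔭R(G)·e_C`, where `C` is the class
of `g`. -/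
noncomputable def blockLocRank (p : ℕ) (𝒪 : Type*) (K : Type u) [CommRing 𝒪] [IsDomain 𝒪]
    [Field K] [Algebra 𝒪 K] [IsFractionRing 𝒪 K] (𝔭 : Ideal 𝒪) [𝔭.IsPrime]
    (G : Type u) [Group G] (g : G) : ℕ :=
  letI := locModule 𝒪 K 𝔭 G
  Module.finrank (Localization.AtPrime 𝔭)
    (Submodule.span (Localization.AtPrime 𝔭)
      {f : G → K | f ∈ locCharRing 𝒪 K 𝔭 G ∧ f * eFun p K g = f})

namespace PrincipalBlock

section Induction

variable {K G : Type u} [Field K] [Group G] {H : Subgroup G}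

/-- The trace of an endomorphism of a finite power of `V` is the sum of the traces of its
diagonal blocks. -/
lemma trace_pi_eq_sum {ι V : Type*} [Fintype ι] [DecidableEq ι] [AddCommGroup V] [Module K V]
    [FiniteDimensional K V] (F : (ι → V) →ₗ[K] (ι → V)) :
    LinearMap.trace K (ι → V) F =
      ∑ i, LinearMap.trace K V (LinearMap.proj i ∘ₗ F ∘ₗ LinearMap.single K (fun _ => V) i) := by
  let b := Module.finBasis K V
  rw [LinearMap.trace_eq_matrix_trace K (Pi.basis fun _ : ι => b), Matrix.trace,
    Fintype.sum_sigma]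
  refine Finset.sum_congr rfl fun i _ => ?_
  rw [LinearMap.trace_eq_matrix_trace K b, Matrix.trace]
  refine Finset.sum_congr rfl fun j _ => ?_
  simp [Matrix.diag, LinearMap.toMatrix_apply, Pi.basis_apply, Pi.basis_repr]

/-- The action cocycle `G × G ⧸ H → H` attached to the chosen representatives of the cosets. -/
noncomputable def cosetCocycle (H : Subgroup G) (g : G) (y : G ⧸ H) : H :=
  ⟨y.out⁻¹ * (g * (g⁻¹ • y).out), by
    rw [← QuotientGroup.eq, ← smul_eq_mul, ← MulAction.Quotient.smul_coe]
    simp⟩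

lemma cosetCocycle_mul (g k : G) (y : G ⧸ H) :
    cosetCocycle H (g * k) y = cosetCocycle H g y * cosetCocycle H k (g⁻¹ • y) := by
  ext
  simp [cosetCocycle, mul_assoc, mul_smul]

lemma cosetCocycle_one (y : G ⧸ H) : cosetCocycle H 1 y = 1 := by
  ext
  simp [cosetCocycle]

/-- The induced representation, realized on the functions from `G ⧸ H` to `V`. -/
noncomputable def indRep {V : Type*} [AddCommGroup V] [Module K V] (ρ : Representation K H V) :
    Representation K G (G ⧸ H → V) where
  toFun g := LinearMap.pi fun y => ρ (cosetCocycle H g y) ∘ₗ LinearMap.proj (g⁻¹ • y)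
  map_one' := by
    ext
    simp [cosetCocycle_one]
  map_mul' g k := by
    refine LinearMap.ext fun f => funext fun y => ?_
    simp [cosetCocycle_mul, mul_smul]

lemma inv_smul_eq_iff_conj_out_mem (g : G) (y : G ⧸ H) :
    g⁻¹ • y = y ↔ y.out⁻¹ * g * y.out ∈ H := by
  rw [inv_smul_eq_iff, mul_assoc, ← QuotientGroup.eq, ← smul_eq_mul, ← MulAction.Quotient.smul_coe]
  simp

lemma comp_coe_mem_charSet {f : G → K} (hf : f ∈ charSet K G) :
    f ∘ ((↑) : H → G) ∈ charSet K H := by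
  obtain ⟨V, rfl⟩ := hf
  exact ⟨FDRep.of (V.ρ.comp H.subtype), rfl⟩

variable [Fintype (G ⧸ H)]

/-- Induction of functions from `H` to `G`. -/
noncomputable def indFun (K : Type u) [Field K] (H : Subgroup G) [Fintype (G ⧸ H)] :
    (H → K) →ₗ[K] (G → K) where
  toFun f g := ∑ y : G ⧸ H,
    if h : y.out⁻¹ * g * y.out ∈ H then f ⟨y.out⁻¹ * g * y.out, h⟩ else 0
  map_add' f₁ f₂ := by
    ext g
    simp only [Pi.add_apply, ← Finset.sum_add_distrib]
    exact Finset.sum_congr rfl fun y _ => by split_ifs <;> simp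
  map_smul' c f := by
    ext g
    simp only [Pi.smul_apply, RingHom.id_apply, Finset.smul_sum]
    exact Finset.sum_congr rfl fun y _ => by split_ifs <;> simp

lemma indFun_apply (f : H → K) (g : G) :
    indFun K H f g = ∑ y : G ⧸ H,
      if h : y.out⁻¹ * g * y.out ∈ H then f ⟨y.out⁻¹ * g * y.out, h⟩ else 0 := rfl

lemma trace_indRep {V : Type*} [AddCommGroup V] [Module K V] [FiniteDimensional K V]
    (ρ : Representation K H V) (g : G) :
    LinearMap.trace K _ (indRep ρ g) = indFun K H (fun h => LinearMap.trace K V (ρ h)) g := by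
  rw [trace_pi_eq_sum, indFun_apply]
  refine Finset.sum_congr rfl fun y _ => ?_
  split_ifs with h
  · have hy := (inv_smul_eq_iff_conj_out_mem g y).2 h
    congr 1
    ext v
    simp only [indRep, MonoidHom.coe_mk, OneHom.coe_mk, LinearMap.comp_apply, LinearMap.proj_apply,
      LinearMap.pi_apply, LinearMap.single_apply, hy, Pi.single_eq_same]
    congr 2
    ext
    simp [cosetCocycle, hy, mul_assoc]
  · have hy := mt (inv_smul_eq_iff_conj_out_mem g y).1 h
    convert! LinearMap.map_zero _
    ext v
    simp [indRep, hy]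

lemma indFun_mem_charSet {f : H → K} (hf : f ∈ charSet K H) : indFun K H f ∈ charSet K G := by
  obtain ⟨V, rfl⟩ := hf
  refine ⟨FDRep.of (indRep V.ρ), funext fun g => ?_⟩
  exact (trace_indRep V.ρ g).symm

/-- The projection formula for induction. -/
lemma indFun_comp_coe_mul {f : G → K} (hf : ∀ g x, f (x * g * x⁻¹) = f g) (u : H → K) :
    indFun K H ((f ∘ (↑)) * u) = f * indFun K H u := by
  ext g
  simp only [indFun_apply, Pi.mul_apply, Finset.mul_sum]
  refine Finset.sum_congr rfl fun y _ => ?_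
  split_ifs
  · congr 1
    simpa using hf g y.out⁻¹
  · simp

lemma indFun_one_apply (g : G) :
    indFun K H 1 g = (Nat.card (MulAction.fixedPoints (Subgroup.zpowers g) (G ⧸ H)) : K) := by
  have h (y : G ⧸ H) : y ∈ MulAction.fixedPoints (Subgroup.zpowers g) (G ⧸ H) ↔
      y.out⁻¹ * g * y.out ∈ H := by
    rw [← inv_smul_eq_iff_conj_out_mem]
    constructor
    · intro hy
      exact inv_smul_eq_iff.2 (hy ⟨g, Subgroup.mem_zpowers g⟩).symm
    · rintro hy ⟨x, hx⟩
      have : x ∈ MulAction.stabilizer G y :=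
        Subgroup.zpowers_le.2 (inv_smul_eq_iff.1 hy).symm hx
      exact this
  rw [indFun_apply]
  simp_rw [← h]
  simp [Nat.card_eq_fintype_card, Fintype.card_subtype]

end Induction

section LocCharRing

variable {𝒪 : Type*} {K G : Type u} [CommRing 𝒪] [Field K] [Algebra 𝒪 K] {𝔭 : Ideal 𝒪} [Group G]

lemma mul_mem_charSet {f g : G → K} (hf : f ∈ charSet K G) (hg : g ∈ charSet K G) :
    f * g ∈ charSet K G := by
  obtain ⟨V, rfl⟩ := hf
  obtain ⟨W, rfl⟩ := hg
  exact ⟨_, (FDRep.char_tensor V W).symm⟩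

lemma one_mem_charSet : (1 : G → K) ∈ charSet K G :=
  ⟨FDRep.of (Representation.trivial K G K), funext fun g => by
    simp [FDRep.character]⟩

lemma const_mem_locCharRing {x : K} (hx : x ∈ locSet 𝒪 K 𝔭) :
    Function.const G x ∈ locCharRing 𝒪 K 𝔭 G :=
  Subring.subset_closure (Or.inl ⟨x, hx, rfl⟩)

lemma charSet_subset_locCharRing : charSet K G ⊆ locCharRing 𝒪 K 𝔭 G :=
  fun _ h => Subring.subset_closure (Or.inr h)

lemma smul_mem_locCharRing {x : K} (hx : x ∈ locSet 𝒪 K 𝔭) {f : G → K}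
    (hf : f ∈ locCharRing 𝒪 K 𝔭 G) : x • f ∈ locCharRing 𝒪 K 𝔭 G := by
  have : x • f = Function.const G x * f := by ext; simp
  exact this ▸ mul_mem (const_mem_locCharRing hx) hf

variable [𝔭.IsPrime]

lemma mul_mem_locSet {x y : K} (hx : x ∈ locSet 𝒪 K 𝔭) (hy : y ∈ locSet 𝒪 K 𝔭) :
    x * y ∈ locSet 𝒪 K 𝔭 := by
  obtain ⟨a, b, hb, h⟩ := hx
  obtain ⟨a', b', hb', h'⟩ := hy
  refine ⟨a * a', b * b', ‹𝔭.IsPrime›.mul_notMem hb hb', ?_⟩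
  rw [map_mul, map_mul, ← h, ← h']
  ring

lemma algebraMap_mem_locSet (a : 𝒪) : algebraMap 𝒪 K a ∈ locSet 𝒪 K 𝔭 :=
  ⟨a, 1, 𝔭.one_notMem, by simp⟩

/-- `𝒪_𝔭R(G)` is additively generated by the multiples of characters by constants. -/
lemma locCharRing_induction {P : (G → K) → Prop}
    (smul : ∀ x ∈ locSet 𝒪 K 𝔭, ∀ χ ∈ charSet K G, P (x • χ))
    (zero : P 0) (hadd : ∀ f g, P f → P g → P (f + g)) (neg : ∀ f, P f → P (-f))
    {f : G → K} (hf : f ∈ locCharRing 𝒪 K 𝔭 G) : P f := by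
  rw [locCharRing, Subring.mem_closure_iff] at hf
  refine AddSubgroup.closure_induction (p := fun f _ => P f) (fun f hf => ?_) zero
    (fun f g _ _ => hadd f g) (fun f _ => neg f) hf
  suffices ∃ x ∈ locSet 𝒪 K 𝔭, ∃ χ ∈ charSet K G, f = x • χ by
    obtain ⟨x, hx, χ, hχ, rfl⟩ := this
    exact smul x hx χ hχ
  have hone : (1 : K) ∈ locSet 𝒪 K 𝔭 := by simpa using algebraMap_mem_locSet (K := K) (1 : 𝒪)
  induction hf using Submonoid.closure_induction with
  | mem f hf =>
    obtain ⟨x, hx, rfl⟩ | hf := hf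
    · exact ⟨x, hx, 1, one_mem_charSet, by ext; simp⟩
    · exact ⟨1, hone, f, hf, by simp⟩
  | one => exact ⟨1, hone, 1, one_mem_charSet, by simp⟩
  | mul f g _ _ hf hg =>
    obtain ⟨x, hx, χ, hχ, rfl⟩ := hf
    obtain ⟨y, hy, η, hη, rfl⟩ := hg
    exact ⟨x * y, mul_mem_locSet hx hy, χ * η, mul_mem_charSet hχ hη, by
      rw [smul_mul_smul_comm]⟩

lemma apply_conj_of_mem_locCharRing {f : G → K} (hf : f ∈ locCharRing 𝒪 K 𝔭 G) (g x : G) :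
    f (x * g * x⁻¹) = f g := by
  refine locCharRing_induction (P := fun f => f (x * g * x⁻¹) = f g) ?_ ?_ ?_ ?_ hf
  · rintro c - _ ⟨V, rfl⟩
    simp [FDRep.char_conj]
  · rfl
  · intro f g hf hg
    simp [hf, hg]
  · intro f hf
    simp [hf]

variable {H : Subgroup G}

lemma comp_coe_mem_locCharRing {f : G → K} (hf : f ∈ locCharRing 𝒪 K 𝔭 G) :
    f ∘ ((↑) : H → G) ∈ locCharRing 𝒪 K 𝔭 H := by
  refine locCharRing_induction (P := fun f => f ∘ ((↑) : H → G) ∈ locCharRing 𝒪 K 𝔭 H) ?_ ?_ ?_ ?_ hf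
  · exact fun c hc χ hχ =>
      smul_mem_locCharRing hc (charSet_subset_locCharRing (comp_coe_mem_charSet hχ))
  · exact zero_mem _
  · exact fun f g hf hg => add_mem hf hg
  · exact fun f hf => neg_mem hf

lemma indFun_mem_locCharRing [Fintype (G ⧸ H)] {f : H → K} (hf : f ∈ locCharRing 𝒪 K 𝔭 H) :
    indFun K H f ∈ locCharRing 𝒪 K 𝔭 G := by
  refine locCharRing_induction (P := fun f => indFun K H f ∈ locCharRing 𝒪 K 𝔭 G) ?_ ?_ ?_ ?_ hf
  · intro c hc χ hχ
    rw [map_smul]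
    exact smul_mem_locCharRing hc (charSet_subset_locCharRing (indFun_mem_charSet hχ))
  · simp [zero_mem]
  · intro f g hf hg
    rw [map_add]
    exact add_mem hf hg
  · intro f hf
    rw [map_neg]
    exact neg_mem hf

/-- Restriction of class functions, as a ring morphism `𝒪_𝔭R(G) →+* 𝒪_𝔭R(H)`. -/
def resHom (𝒪 : Type*) (K : Type u) [CommRing 𝒪] [Field K] [Algebra 𝒪 K] (𝔭 : Ideal 𝒪)
    [𝔭.IsPrime] (H : Subgroup G) : locCharRing 𝒪 K 𝔭 G →+* locCharRing 𝒪 K 𝔭 H where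
  toFun f := ⟨(f : G → K) ∘ (↑), comp_coe_mem_locCharRing f.2⟩
  map_one' := rfl
  map_mul' _ _ := rfl
  map_zero' := rfl
  map_add' _ _ := rfl

end LocCharRing

section Commutative

lemma exists_compl_of_projection {R E : Type*} [Ring R] [AddCommGroup E] [Module R E]
    {S M : Submodule R E} (hSM : S ≤ M) (P : E →ₗ[R] E) (hP : M ≤ S.comap P)
    (hS : S ≤ LinearMap.eqLocus P LinearMap.id) : ∃ N ≤ M, S ⊔ N = M ∧ S ⊓ N = ⊥ := by
  refine ⟨M ⊓ LinearMap.ker P, inf_le_left, le_antisymm (sup_le hSM inf_le_left) fun x hx => ?_,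
    (Submodule.eq_bot_iff _).2 ?_⟩
  · refine Submodule.mem_sup.2 ⟨P x, hP hx, x - P x, ⟨?_, ?_⟩, add_sub_cancel _ _⟩
    · exact sub_mem hx (hSM (hP hx))
    · simp [show P (P x) = P x from hS (hP hx)]
  · rintro x ⟨hx, -, hx'⟩
    rw [← show P x = x from hS hx]
    exact hx'

/-- An ideal `I` is contracted from its extension along `r : A →+* B` as soon as there is an
`A`-linear map `B → A` sending `1` to an element congruent to `1` modulo `I`. -/
lemma comap_map_eq_of_transfer {A B : Type*} [CommRing A] [CommRing B] (r : A →+* B) (T : B →+ A)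
    (hT : ∀ a b, T (r a * b) = a * T b) {I : Ideal A} (hI : 1 - T 1 ∈ I) :
    (I.map r).comap r = I := by
  refine le_antisymm (fun a ha => ?_) Ideal.le_comap_map
  have key : ∀ b ∈ I.map r, ∀ c, T (c * b) ∈ I := fun b hb => by
    refine Submodule.span_induction ?_ (by simp) (fun x y _ _ hx hy c => ?_) ?_ hb
    · rintro _ ⟨a, ha, rfl⟩ c
      rw [mul_comm, hT]
      exact I.mul_mem_right _ ha
    · rw [mul_add, map_add]
      exact add_mem (hx c) (hy c)
    · intro d x _ hx c
      rw [smul_eq_mul, ← mul_assoc]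
      exact hx _
  have h := key _ ha 1
  rw [mul_comm, hT] at h
  have := add_mem h (I.mul_mem_left a hI)
  rwa [← mul_add, add_sub_cancel, mul_one] at this

lemma loewyLength_le_of_injective {A B : Type*} [CommRing A] [CommRing B] [IsArtinianRing A]
    [IsArtinianRing B] (ψ : A →+* B) (hψ : Function.Injective ψ) :
    loewyLength A ≤ loewyLength B := by
  have hB : jacRad B ^ loewyLength B = ⊥ :=
    Nat.sInf_mem (s := {n : ℕ | jacRad B ^ n = ⊥}) IsArtinianRing.isNilpotent_jacobson_bot
  obtain ⟨n, hn⟩ := IsArtinianRing.isNilpotent_jacobson_bot (R := A)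
  have hle : (jacRad A).map ψ ≤ jacRad B := by
    refine Ideal.map_le_iff_le_comap.2 fun a ha => ?_
    have : IsNilpotent (ψ a) := by
      refine IsNilpotent.map ⟨n, ?_⟩ ψ
      have := Ideal.pow_mem_pow ha n
      rwa [jacRad, hn] at this
    exact Ideal.mem_comap.2 (Ideal.radical_le_jacobson (I := ⊥) this)
  refine Nat.sInf_le ((Ideal.map_eq_bot_iff_of_injective hψ).1 ?_)
  rw [Ideal.map_pow, eq_bot_iff, ← hB]
  exact Ideal.pow_right_mono hle _

end Commutative

section Transfer

variable {p : ℕ} {K G : Type u} [Field K] [Group G]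

lemma isPElement_of_pPrimePart_eq_one [Fact p.Prime] [Finite G] {x : G}
    (h : pPrimePart p x = 1) : IsPElement p x := by
  set n := orderOf x with hn
  set v := n.factorization p with hv
  have hn0 : n ≠ 0 := (orderOf_pos x).ne'
  have hcop : p.Coprime (n / p ^ v) := Nat.coprime_ordCompl Fact.out hn0
  have hmul : p ^ v * (n / p ^ v) = n := Nat.ordProj_mul_ordCompl_eq_self n p
  set m := n / p ^ v with hm
  have hdvd : p ^ v * m ∣ p ^ v * ((p : ZMod m) ^ v)⁻¹.val := by
    rw [hmul]
    exact orderOf_dvd_of_pow_eq_one h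
  have hz := (ZMod.natCast_eq_zero_iff _ m).2
    (Nat.dvd_of_mul_dvd_mul_left (pow_pos (Fact.out : p.Prime).pos v) hdvd)
  have hm0 : m ≠ 0 := by
    rintro h0
    simp [h0] at hmul
    omega
  have : NeZero m := ⟨hm0⟩
  rw [ZMod.natCast_zmod_val] at hz
  have hone : ((p : ZMod m) ^ v) * ((p : ZMod m) ^ v)⁻¹ = 1 := by
    have := ZMod.coe_mul_inv_eq_one (p ^ v) (hcop.pow_left v)
    simpa using this
  rw [hz, mul_zero] at hone
  have hm1 : m = 1 := by
    have := (ZMod.natCast_eq_zero_iff 1 m).1 (by simpa using hone.symm)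
    exact Nat.dvd_one.1 this
  exact ⟨v, by rw [← hn, ← hmul, hm1, mul_one]⟩

lemma eFun_one_apply (x : G) : eFun p K (1 : G) x = if pPrimePart p x = 1 then 1 else 0 := by
  simp [eFun, eq_comm (a := (1 : G))]

lemma eFun_one_mul_self : eFun p K (1 : G) * eFun p K (1 : G) = eFun p K (1 : G) := by
  ext x
  simp [eFun_one_apply]

lemma eFun_one_comp_coe (H : Subgroup G) :
    eFun p K (1 : G) ∘ ((↑) : H → G) = eFun p K (1 : H) := by
  ext x
  have : pPrimePart p (x : G) = pPrimePart p x := by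
    rw [pPrimePart, Subgroup.orderOf_coe, ← Subgroup.coe_pow, ← pPrimePart]
  simp [eFun_one_apply, this]

variable {𝒪 : Type*} [CommRing 𝒪] [Algebra 𝒪 K] {𝔭 : Ideal 𝒪} [𝔭.IsPrime]

lemma inv_intCast_mem_locSet [Fact p.Prime] (hp : (p : 𝒪) ∈ 𝔭) {n : ℤ}
    (hn : IsCoprime n p) : (n : K)⁻¹ ∈ locSet 𝒪 K 𝔭 := by
  have hn𝔭 : (n : 𝒪) ∉ 𝔭 := by
    intro h
    obtain ⟨a, b, hab⟩ := hn
    refine 𝔭.one_notMem ?_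
    have : ((a * n + b * p : ℤ) : 𝒪) = 1 := by simp [hab]
    rw [← this]
    push_cast
    exact add_mem (𝔭.mul_mem_left _ h) (𝔭.mul_mem_left _ hp)
  by_cases h0 : (n : K) = 0
  · exact ⟨0, 1, 𝔭.one_notMem, by simp [h0]⟩
  · exact ⟨1, n, hn𝔭, by simp [h0]⟩

lemma coprime_card_fixedPoints_zpowers [Fact p.Prime] [Finite G] {H : Subgroup G}
    (hind : Nat.Coprime H.index p) {g : G} (hg : IsPElement p g) :
    (Nat.card (MulAction.fixedPoints (Subgroup.zpowers g) (G ⧸ H))).Coprime p := by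
  obtain ⟨n, hn⟩ := hg
  have hP : IsPGroup p (Subgroup.zpowers g) := IsPGroup.of_card (by rw [Nat.card_zpowers, hn])
  have := hP.card_modEq_card_fixedPoints (G ⧸ H)
  rw [Nat.coprime_comm, (Fact.out : p.Prime).coprime_iff_not_dvd, ← (this.dvd_iff dvd_rfl)]
  rwa [← (Fact.out : p.Prime).coprime_iff_not_dvd, Nat.coprime_comm]

lemma exists_indFun_one_mul_eFun_eq [CharZero K] [Fact p.Prime] (hp : (p : 𝒪) ∈ 𝔭) [Finite G]
    {H : Subgroup G} [Fintype (G ⧸ H)] (hind : Nat.Coprime H.index p) :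
    ∃ b ∈ locCharRing 𝒪 K 𝔭 G, indFun K H 1 * b * eFun p K (1 : G) = eFun p K (1 : G) := by
  have := Fintype.ofFinite G
  let c (g : G) : ℤ := Nat.card (MulAction.fixedPoints (Subgroup.zpowers g) (G ⧸ H))
  let P : Polynomial ℤ := ∏ g with pPrimePart p g = 1, (Polynomial.X - Polynomial.C (c g))
  have hP0 : IsCoprime (P.coeff 0) p := by
    rw [Polynomial.coeff_zero_eq_eval_zero, Polynomial.eval_prod]
    refine IsCoprime.prod_left fun g hg => ?_
    have := coprime_card_fixedPoints_zpowers hind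
      (isPElement_of_pPrimePart_eq_one (Finset.mem_filter.1 hg).2)
    rw [← Nat.isCoprime_iff_coprime] at this
    simpa only [Polynomial.eval_sub, Polynomial.eval_X, Polynomial.eval_C, zero_sub] using
      this.neg_left
  have hP0' : ((P.coeff 0 : ℤ) : K) ≠ 0 := by
    rw [Int.cast_ne_zero]
    intro h
    rw [h, isCoprime_zero_left, Int.isUnit_iff] at hP0
    have := (Fact.out : p.Prime).two_le
    omega
  let a : locCharRing 𝒪 K 𝔭 G :=
    ⟨indFun K H 1, indFun_mem_locCharRing (one_mem _)⟩
  refine ⟨(-(P.coeff 0 : K)⁻¹) • (Polynomial.aeval a P.divX : locCharRing 𝒪 K 𝔭 G),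
    ?_, ?_⟩
  · rw [neg_smul]
    exact neg_mem (smul_mem_locCharRing (inv_intCast_mem_locSet hp hP0) (Subtype.prop _))
  · ext g
    simp only [Pi.mul_apply, eFun_one_apply]
    split_ifs with hg
    · have hroot : Polynomial.aeval (c g : K) P = 0 := by
        rw [map_prod]
        exact Finset.prod_eq_zero (i := g) (by simpa using hg) (by simp)
      have hval : (Polynomial.aeval a P.divX : locCharRing 𝒪 K 𝔭 G).1 g =
          Polynomial.aeval (c g : K) P.divX := by
        have := Polynomial.aeval_algHom_apply
          (((Pi.evalRingHom (fun _ : G => K) g).comp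
            (locCharRing 𝒪 K 𝔭 G).subtype).toIntAlgHom) a P.divX
        simpa [a, c, indFun_one_apply] using this.symm
      rw [← Polynomial.divX_mul_X_add P] at hroot
      simp only [map_add, map_mul, Polynomial.aeval_X, Polynomial.aeval_C] at hroot
      simp only [Pi.smul_apply, hval, indFun_one_apply]
      rw [smul_eq_mul, mul_one]
      simp only [eq_intCast, c, Int.cast_natCast] at hroot ⊢
      linear_combination -(P.coeff 0 : K)⁻¹ * hroot + mul_inv_cancel₀ hP0'
    · simp

/-- The transfer map splitting the restriction of principal blocks. -/
lemma exists_transfer [CharZero K] [Fact p.Prime] (hp : (p : 𝒪) ∈ 𝔭) [Finite G]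
    {H : Subgroup G} (hind : Nat.Coprime H.index p)
    (he : eFun p K (1 : G) ∈ locCharRing 𝒪 K 𝔭 G) :
    ∃ T : (H → K) →ₗ[K] (G → K), (∀ u ∈ locCharRing 𝒪 K 𝔭 H, T u ∈ locCharRing 𝒪 K 𝔭 G) ∧
      (∀ u, T u * eFun p K (1 : G) = T u) ∧
      (∀ f ∈ locCharRing 𝒪 K 𝔭 G, ∀ u, T (f ∘ (↑) * u) = f * T u) ∧
      T 1 = eFun p K (1 : G) := by
  have := Fintype.ofFinite (G ⧸ H)
  obtain ⟨b, hb, hbe⟩ := exists_indFun_one_mul_eFun_eq (K := K) hp hind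
  refine ⟨LinearMap.mulLeft K (b * eFun p K (1 : G)) ∘ₗ indFun K H, fun u hu => ?_, fun u => ?_,
    fun f hf u => ?_, ?_⟩
  · exact mul_mem (mul_mem hb he) (indFun_mem_locCharRing hu)
  · simp only [LinearMap.comp_apply, LinearMap.mulLeft_apply]
    rw [mul_right_comm, mul_assoc b, eFun_one_mul_self]
  · simp only [LinearMap.comp_apply, LinearMap.mulLeft_apply]
    rw [indFun_comp_coe_mul (apply_conj_of_mem_locCharRing hf), mul_left_comm]
  · simp only [LinearMap.comp_apply, LinearMap.mulLeft_apply]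
    rw [mul_right_comm, mul_comm b, hbe]

end Transfer

section Artinian

lemma isIntegral_trace_of_pow_eq_one {K V : Type*} [Field K] [AddCommGroup V] [Module K V]
    [FiniteDimensional K V] {f : Module.End K V} {n : ℕ} (hn : 0 < n) (hf : f ^ n = 1) :
    IsIntegral ℤ (LinearMap.trace K V f) := by
  let b := Module.finBasis K V
  let L := AlgebraicClosure K
  let A := (LinearMap.toMatrix b b f).map (algebraMap K L)
  have hA : A ^ n = 1 := by
    have h : A = (algebraMap K L).mapMatrix (LinearMap.toMatrixAlgEquiv b f) := rfl
    rw [h, ← map_pow, ← map_pow, hf, map_one, map_one]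
  rw [← isIntegral_algebraMap_iff (B := L) (algebraMap K L).injective,
    LinearMap.trace_eq_matrix_trace K b,
    show algebraMap K L (Matrix.trace (LinearMap.toMatrix b b f)) = A.trace from
      AddMonoidHom.map_trace (algebraMap K L) _, Matrix.trace_eq_sum_roots_charpoly]
  refine IsIntegral.multiset_sum fun μ hμ => ?_
  have hμ' := spectrum.pow_mem_pow A n
    (Matrix.mem_spectrum_of_isRoot_charpoly (Polynomial.isRoot_of_mem_roots hμ))
  rw [hA] at hμ'
  have hroot : μ ^ n = 1 := by
    by_contra h
    refine hμ' ?_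
    have := (sub_ne_zero.2 h).isUnit.map (algebraMap L (Matrix (Fin (Module.finrank K V)) (Fin (Module.finrank K V)) L))
    rwa [map_sub, map_one] at this
  exact IsIntegral.of_pow hn (hroot ▸ isIntegral_one)

variable {𝒪 : Type*} [CommRing 𝒪] [IsDomain 𝒪] {K : Type u} [Field K] [Algebra 𝒪 K]
  [IsFractionRing 𝒪 K] {𝔭 : Ideal 𝒪} {G : Type u} [Group G]

section

variable [𝔭.IsPrime]

lemma locToK_algebraMap (a : 𝒪) : locToK 𝒪 K 𝔭 (algebraMap 𝒪 _ a) = algebraMap 𝒪 K a :=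
  IsLocalization.lift_eq _ _

lemma mem_range_locToK {x : K} : x ∈ (locToK 𝒪 K 𝔭).range ↔ x ∈ locSet 𝒪 K 𝔭 := by
  have h0 : ∀ b ∉ 𝔭, algebraMap 𝒪 K b ≠ 0 := fun b hb h => hb <| by
    rw [(IsFractionRing.to_map_eq_zero_iff (K := K)).1 h]
    exact 𝔭.zero_mem
  constructor
  · rintro ⟨y, rfl⟩
    obtain ⟨a, b, rfl⟩ := IsLocalization.exists_mk'_eq 𝔭.primeCompl y
    refine ⟨a, b, b.2, ?_⟩
    rw [← locToK_algebraMap (𝔭 := 𝔭), ← map_mul, IsLocalization.mk'_spec, locToK_algebraMap]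
  · rintro ⟨a, b, hb, h⟩
    refine ⟨IsLocalization.mk' _ a (⟨b, hb⟩ : 𝔭.primeCompl), ?_⟩
    refine mul_right_cancel₀ (h0 b hb) ?_
    rw [h, ← locToK_algebraMap (K := K) (𝔭 := 𝔭) b, ← map_mul]
    exact (congrArg _ (IsLocalization.mk'_spec _ a (⟨b, hb⟩ : 𝔭.primeCompl))).trans
      (locToK_algebraMap a)

/-- The constants, as a ring morphism `𝒪_𝔭 →+* 𝒪_𝔭R(G)`. -/
noncomputable def locConstRingHom (𝒪 : Type*) [CommRing 𝒪] [IsDomain 𝒪] (K : Type u) [Field K]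
    [Algebra 𝒪 K] [IsFractionRing 𝒪 K] (𝔭 : Ideal 𝒪) (G : Type u) [Group G] [𝔭.IsPrime] :
    Localization.AtPrime 𝔭 →+* locCharRing 𝒪 K 𝔭 G :=
  ((algebraMap K (G → K)).comp (locToK 𝒪 K 𝔭)).codRestrict _ fun x =>
    const_mem_locCharRing (mem_range_locToK.1 ⟨x, rfl⟩)

lemma apply_mem_range_locToK [IsIntegrallyClosed 𝒪] [Finite G] {f : G → K}
    (hf : f ∈ locCharRing 𝒪 K 𝔭 G) (g : G) : f g ∈ (locToK 𝒪 K 𝔭).range := by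
  refine locCharRing_induction (P := fun f => f g ∈ (locToK 𝒪 K 𝔭).range) ?_ ?_ ?_ ?_ hf
  · rintro x hx _ ⟨V, rfl⟩
    have hV : IsIntegral 𝒪 (V.character g) :=
      (isIntegral_trace_of_pow_eq_one (orderOf_pos g)
        (by rw [← map_pow, pow_orderOf_eq_one, map_one])).tower_top
    obtain ⟨a, ha⟩ := IsIntegrallyClosed.isIntegral_iff.1 hV
    rw [Pi.smul_apply, ← ha]
    exact mul_mem (mem_range_locToK.2 hx) ⟨_, locToK_algebraMap a⟩
  · exact zero_mem _
  · exact fun _ _ => add_mem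
  · exact fun _ => neg_mem

lemma finite_locConstRingHom [IsIntegrallyClosed 𝒪] [IsNoetherianRing 𝒪] [Finite G] :
    (locConstRingHom 𝒪 K 𝔭 G).Finite := by
  let R := Localization.AtPrime 𝔭
  have : IsNoetherianRing R := IsLocalization.isNoetherianRing 𝔭.primeCompl R inferInstance
  let : Algebra R K := (locToK 𝒪 K 𝔭).toAlgebra
  let : Algebra R (locCharRing 𝒪 K 𝔭 G) := (locConstRingHom 𝒪 K 𝔭 G).toAlgebra
  let E : (G → R) →ₗ[R] (G → K) := (Algebra.linearMap R K).compLeft G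
  let i : locCharRing 𝒪 K 𝔭 G →ₗ[R] (G → K) :=
    { (locCharRing 𝒪 K 𝔭 G).subtype with
      map_smul' := fun x f => by
        ext g
        rw [RingHom.id_apply, Algebra.smul_def, Pi.smul_apply, Algebra.smul_def]
        rfl }
  have hi : ∀ f, i f ∈ LinearMap.range E := fun f => by
    choose y hy using apply_mem_range_locToK f.2
    exact ⟨y, funext hy⟩
  have : IsNoetherian R (locCharRing 𝒪 K 𝔭 G) :=
    isNoetherian_of_injective (i.codRestrict _ hi) fun f₁ f₂ h => by
      have h' := Subtype.ext_iff.1 h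
      exact Subtype.ext h'
  exact Module.IsNoetherian.finite R _

end

/-- The quotients of `kR(G)` are artinian. -/
lemma isArtinianRing_quotient [𝔭.IsMaximal] [IsIntegrallyClosed 𝒪] [IsNoetherianRing 𝒪]
    [Finite G] {I : Ideal (locCharRing 𝒪 K 𝔭 G)} (hI : pConstIdeal 𝒪 K 𝔭 G ≤ I) :
    IsArtinianRing (locCharRing 𝒪 K 𝔭 G ⧸ I) := by
  let R := Localization.AtPrime 𝔭
  let φ : R →+* locCharRing 𝒪 K 𝔭 G ⧸ I := (Ideal.Quotient.mk I).comp (locConstRingHom 𝒪 K 𝔭 G)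
  have hφ : φ.Finite :=
    (RingHom.Finite.of_surjective _ Ideal.Quotient.mk_surjective).comp finite_locConstRingHom
  have hker : IsLocalRing.maximalIdeal R ≤ RingHom.ker φ := by
    rw [← IsLocalization.AtPrime.map_eq_maximalIdeal 𝔭 R, Ideal.map_le_iff_le_comap]
    intro a ha
    refine Ideal.Quotient.eq_zero_iff_mem.2 (hI (Ideal.subset_span ⟨a, ha, ?_⟩))
    ext g
    exact locToK_algebraMap a
  let φ' := Ideal.Quotient.lift (IsLocalRing.maximalIdeal R) φ hker
  have hφ' : φ'.Finite := RingHom.Finite.of_comp_finite (f := Ideal.Quotient.mk _) <| by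
    rwa [show φ'.comp (Ideal.Quotient.mk _) = φ from Ideal.Quotient.lift_comp_mk _ φ hker]
  let : Field (R ⧸ IsLocalRing.maximalIdeal R) := Ideal.Quotient.field _
  let := φ'.toAlgebra
  have : Module.Finite (R ⧸ IsLocalRing.maximalIdeal R) (locCharRing 𝒪 K 𝔭 G ⧸ I) := hφ'
  exact IsArtinianRing.of_finite (R ⧸ IsLocalRing.maximalIdeal R) _

end Artinian

end PrincipalBlock

variable {𝒪 : Type*} [CommRing 𝒪] [IsDomain 𝒪] [IsDedekindDomain 𝒪] [CharZero 𝒪]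
variable {K : Type u} [Field K] [Algebra 𝒪 K] [IsFractionRing 𝒪 K]
variable {𝔭 : Ideal 𝒪} [𝔭.IsMaximal]

set_option maxHeartbeats 2000000 in
set_option synthInstance.maxHeartbeats 1000000 in
/-- If `H ≤ G` has index prime to `p`, then restriction of class functions
maps the principal block `R_𝔭(G,1)` into `R_𝔭(H,1)`, is an injective morphism of
`𝒪_𝔭`-algebras, and its image is a direct summand of the `𝒪_𝔭`-module `R_𝔭(H,1)`.
Consequently the induced map of principal blocks `kR_𝔭(G,1) → kR_𝔭(H,1)` is an injective
`k`-algebra morphism, and `ℓ_p(G,1) ≤ ℓ_p(H,1)`. -/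
theorem principal_block_restriction_split_injection
    (p : ℕ) [Fact p.Prime] (hp : (p : 𝒪) ∈ 𝔭)
    {G : Type u} [Group G] [Finite G]
    (ζ : K) (hζ : IsPrimitiveRoot ζ (Nat.card G))
    (H : Subgroup G) (hind : Nat.Coprime H.index p)
    (he1G : eFun p K (1 : G) ∈ locCharRing 𝒪 K 𝔭 G)
    (he1H : eFun p K (1 : H) ∈ locCharRing 𝒪 K 𝔭 H) :
    ((eFun p K (1 : G)) ∘ ((↑) : H → G) = eFun p K (1 : H)) ∧
    (∀ f : G → K, f ∈ locCharRing 𝒪 K 𝔭 G → f * eFun p K (1 : G) = f →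
        (f ∘ ((↑) : H → G)) ∈ locCharRing 𝒪 K 𝔭 H ∧
        (f ∘ ((↑) : H → G)) * eFun p K (1 : H) = f ∘ ((↑) : H → G)) ∧
    (∀ f₁ f₂ : G → K,
        f₁ ∈ locCharRing 𝒪 K 𝔭 G → f₁ * eFun p K (1 : G) = f₁ →
        f₂ ∈ locCharRing 𝒪 K 𝔭 G → f₂ * eFun p K (1 : G) = f₂ →
        f₁ ∘ ((↑) : H → G) = f₂ ∘ ((↑) : H → G) → f₁ = f₂) ∧
    (letI := locModule 𝒪 K 𝔭 H
     ∃ N : Submodule (Localization.AtPrime 𝔭) (H → K),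
       N ≤ Submodule.span (Localization.AtPrime 𝔭)
           {f : H → K | f ∈ locCharRing 𝒪 K 𝔭 H ∧ f * eFun p K (1 : H) = f} ∧
       Submodule.span (Localization.AtPrime 𝔭)
           {f : H → K | ∃ u : G → K, u ∈ locCharRing 𝒪 K 𝔭 G ∧
              u * eFun p K (1 : G) = u ∧ f = u ∘ ((↑) : H → G)} ⊔ N =
         Submodule.span (Localization.AtPrime 𝔭)
           {f : H → K | f ∈ locCharRing 𝒪 K 𝔭 H ∧ f * eFun p K (1 : H) = f} ∧
       Submodule.span (Localization.AtPrime 𝔭)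
           {f : H → K | ∃ u : G → K, u ∈ locCharRing 𝒪 K 𝔭 G ∧
              u * eFun p K (1 : G) = u ∧ f = u ∘ ((↑) : H → G)} ⊓ N = ⊥) ∧
    (∃ ψ : blockAlg 𝒪 K 𝔭 G ⟨eFun p K (1 : G), he1G⟩ →+*
        blockAlg 𝒪 K 𝔭 H ⟨eFun p K (1 : H), he1H⟩,
      Function.Injective ψ ∧
      ψ.comp (blockScalars 𝒪 K 𝔭 G ⟨eFun p K (1 : G), he1G⟩) =
        blockScalars 𝒪 K 𝔭 H ⟨eFun p K (1 : H), he1H⟩ ∧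
      ∀ (f : locCharRing 𝒪 K 𝔭 G)
        (hf : ((f : G → K) ∘ ((↑) : H → G)) ∈ locCharRing 𝒪 K 𝔭 H),
        ψ (Ideal.Quotient.mk (blockIdeal 𝒪 K 𝔭 G ⟨eFun p K (1 : G), he1G⟩) f) =
          Ideal.Quotient.mk (blockIdeal 𝒪 K 𝔭 H ⟨eFun p K (1 : H), he1H⟩)
            ⟨(f : G → K) ∘ ((↑) : H → G), hf⟩) ∧
    loewyLength (blockAlg 𝒪 K 𝔭 G ⟨eFun p K (1 : G), he1G⟩) ≤
      loewyLength (blockAlg 𝒪 K 𝔭 H ⟨eFun p K (1 : H), he1H⟩) := by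
  have : CharZero K := charZero_of_injective_algebraMap (IsFractionRing.injective 𝒪 K)
  obtain ⟨T, hTmem, hTe, hTmul, hTone⟩ := PrincipalBlock.exists_transfer (K := K) hp hind he1G
  have hres := PrincipalBlock.eFun_one_comp_coe (p := p) (K := K) H
  have hTres : ∀ f ∈ locCharRing 𝒪 K 𝔭 G, f * eFun p K (1 : G) = f →
      T (f ∘ ((↑) : H → G)) = f := fun f hf hfe => by
    have := hTmul f hf 1
    rwa [mul_one, hTone, hfe] at this
  have hmem : ∀ f ∈ locCharRing 𝒪 K 𝔭 G, f * eFun p K (1 : G) = f →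
      f ∘ ((↑) : H → G) ∈ locCharRing 𝒪 K 𝔭 H ∧
        (f ∘ ((↑) : H → G)) * eFun p K (1 : H) = f ∘ ((↑) : H → G) := fun f hf hfe => by
    refine ⟨PrincipalBlock.comp_coe_mem_locCharRing hf, ?_⟩
    rw [← hres]
    exact congrArg (· ∘ ((↑) : H → G)) hfe
  refine ⟨hres, hmem, fun f₁ f₂ hf₁ he₁ hf₂ he₂ h => ?_, ?_, ?_⟩
  · rw [← hTres f₁ hf₁ he₁, h, hTres f₂ hf₂ he₂]
  · let := locModule 𝒪 K 𝔭 H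
    let P : (H → K) →ₗ[Localization.AtPrime 𝔭] (H → K) :=
      { toFun := fun u => T u ∘ (↑)
        map_add' := fun u v => by
          rw [map_add]
          rfl
        map_smul' := fun c u => by
          have : T (c • u) = locToK 𝒪 K 𝔭 c • T u := T.map_smul (locToK 𝒪 K 𝔭 c) u
          rw [this]
          rfl }
    refine PrincipalBlock.exists_compl_of_projection ?_ P ?_ ?_
    · rw [Submodule.span_le]
      rintro _ ⟨f, hf, hfe, rfl⟩
      exact Submodule.subset_span (hmem f hf hfe)
    · rw [Submodule.span_le]
      rintro u ⟨hu, -⟩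
      exact Submodule.subset_span ⟨T u, hTmem u hu, hTe u, rfl⟩
    · rw [Submodule.span_le]
      rintro _ ⟨f, hf, hfe, rfl⟩
      exact congrArg (· ∘ ((↑) : H → G)) (hTres f hf hfe)
  · let r := PrincipalBlock.resHom 𝒪 K 𝔭 H
    let eG : locCharRing 𝒪 K 𝔭 G := ⟨eFun p K (1 : G), he1G⟩
    let eH : locCharRing 𝒪 K 𝔭 H := ⟨eFun p K (1 : H), he1H⟩
    let T' : locCharRing 𝒪 K 𝔭 H →+ locCharRing 𝒪 K 𝔭 G :=
      { toFun := fun u => ⟨T u, hTmem u u.2⟩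
        map_zero' := Subtype.ext (map_zero T)
        map_add' := fun u v => Subtype.ext (map_add T _ _) }
    have hmap : (blockIdeal 𝒪 K 𝔭 G eG).map r = blockIdeal 𝒪 K 𝔭 H eH := by
      have hr : r (1 - eG) = 1 - eH := by
        rw [map_sub, map_one]
        exact congrArg (1 - ·) (Subtype.ext hres)
      rw [blockIdeal, blockIdeal, Ideal.map_sup, Ideal.map_span, Set.image_singleton, hr,
        pConstIdeal, pConstIdeal, Ideal.map_span]
      congr 2
      ext f
      constructor
      · rintro ⟨f, ⟨a, ha, hf⟩, rfl⟩
        exact ⟨a, ha, congrArg (· ∘ ((↑) : H → G)) hf⟩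
      · rintro ⟨a, ha, hf⟩
        exact ⟨constRingHom 𝒪 K 𝔭 G a, ⟨a, ha, rfl⟩, Subtype.ext hf.symm⟩
    have hcomap : (blockIdeal 𝒪 K 𝔭 H eH).comap r = blockIdeal 𝒪 K 𝔭 G eG := by
      rw [← hmap]
      refine PrincipalBlock.comap_map_eq_of_transfer r T'
        (fun a b => Subtype.ext (hTmul a a.2 b)) ?_
      have : T' 1 = eG := Subtype.ext hTone
      rw [this]
      exact Ideal.mem_sup_right (Ideal.mem_span_singleton_self _)
    let ψ := Ideal.quotientMap (blockIdeal 𝒪 K 𝔭 H eH) r hcomap.ge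
    have hψ : Function.Injective ψ := Ideal.quotientMap_injective' hcomap.le
    refine ⟨⟨ψ, hψ, Ideal.Quotient.ringHom_ext ?_, fun f hf => rfl⟩, ?_⟩
    · rfl
    · have := PrincipalBlock.isArtinianRing_quotient (I := blockIdeal 𝒪 K 𝔭 G eG) le_sup_left
      have := PrincipalBlock.isArtinianRing_quotient (I := blockIdeal 𝒪 K 𝔭 H eH) le_sup_left
      exact PrincipalBlock.loewyLength_le_of_injective ψ hψ
end
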